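/- arXiv:0811.4068 — 7 statements merged into one kernel-verified Lean document; each statement's English description precedes it below -/
import Mathlib

section
/- Fix p > 1. Let w : (−1,1) → ℝ be a C² function satisfying, for all y ∈ (−1,1), (1 − y²) w''(y) − (2(p+1)/(p−1)) y w'(y) − (2(p+1)/(p−1)²) w(y) + w(y)^p = 0, together with w(y) ≥ 0 for all y ∈ (−1,1) and ∫_{−1}^{1} (w'(y)² (1−y²) + w(y)²) ρ(y) dy < ∞. Then either w ≡ 0 on (−1,1), or there exists d ∈ (−1,1) such that w(y) = κ(d,y) for all y ∈ (−1,1). -/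
open Real MeasureTheory Set

lemma aux_energy (p a : ℝ) (hp : 1 < p) (W W1 : ℝ → ℝ)
    (hW : ∀ x, HasDerivAt W (W1 x) x)
    (hW1 : ∀ x, HasDerivAt W1 (a^2 * W x - W x ^ p) x) :
    ∃ E, ∀ x, W1 x ^ 2 / 2 - a^2 / 2 * W x ^ 2 + W x ^ (p+1) / (p+1) = E := by
  refine ⟨W1 0 ^ 2 / 2 - a^2 / 2 * W 0 ^ 2 + W 0 ^ (p+1) / (p+1), fun x => ?_⟩
  have key : ∀ x, HasDerivAt (fun x => W1 x ^ 2 / 2 - a^2 / 2 * W x ^ 2 + W x ^ (p+1) / (p+1)) 0 x := by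
    intro x
    have h := ((((hW1 x).pow 2).div_const 2).sub (((hW x).pow 2).const_mul (a^2/2))).add
      (((hW x).rpow_const (p := p+1) (Or.inr (by linarith))).div_const (p+1))
    refine h.congr_deriv ?_
    have : p + 1 ≠ 0 := by linarith
    rw [add_sub_cancel_right]
    field_simp
    ring
  exact is_const_of_deriv_eq_zero (fun x => (key x).differentiableAt) (fun x => (key x).deriv) x 0

lemma aux_bound (p a E : ℝ) (hp : 1 < p) (W W1 : ℝ → ℝ) (hpos : ∀ x, 0 ≤ W x)
    (hE : ∀ x, W1 x ^ 2 / 2 - a^2 / 2 * W x ^ 2 + W x ^ (p+1) / (p+1) = E) :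
    ∃ M, 0 ≤ M ∧ (∀ x, W x ≤ M) ∧ (∀ x, |W1 x| ≤ M) := by
  set K := (p+1) * (a^2/2 + |E| + 1) with hK
  have hp1 : 0 < p - 1 := by linarith
  have hK0 : 0 ≤ K := by positivity
  set N := max 1 (K ^ (1/(p-1))) with hN
  have hN1 : 1 ≤ N := le_max_left _ _
  have hb : ∀ x, W x ≤ N := by
    intro x
    by_contra! hlt
    have hW0 : 0 < W x := by linarith
    have h1 : K ≤ W x ^ (p-1) := by
      have h2 : K ^ (1/(p-1)) ≤ W x := (le_max_right _ _).trans hlt.le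
      have := Real.rpow_le_rpow (by positivity) h2 hp1.le
      rwa [← Real.rpow_mul hK0, one_div, inv_mul_cancel₀ hp1.ne', Real.rpow_one] at this
    have h3 : W x ^ (p+1) = W x ^ (p-1) * W x ^ 2 := by
      rw [← Real.rpow_natCast, ← Real.rpow_add hW0]; norm_num; ring_nf
    have h4 : K * W x ^ 2 ≤ W x ^ (p+1) := by rw [h3]; gcongr
    have h5 : (a^2/2 + |E| + 1) * W x ^2 ≤ W x ^ (p+1) / (p+1) := by
      rw [le_div_iff₀ (by linarith)]; rw [hK] at h4; linarith
    have h6 : 1 < W x ^ 2 := by nlinarith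
    have := hE x
    have := le_abs_self E
    have := abs_nonneg E
    have hx := sq_nonneg (W1 x)
    nlinarith
  refine ⟨max N (2 * |E| + a^2 * N^2 + 1), by positivity, fun x => (hb x).trans (le_max_left _ _), fun x => ?_⟩
  refine le_trans ?_ (le_max_right _ _)
  have h1 := hE x
  have h2 : 0 ≤ W x ^ (p+1) / (p+1) := div_nonneg (Real.rpow_nonneg (hpos x) _) (by linarith)
  have h3 : W x ^ 2 ≤ N^2 := pow_le_pow_left₀ (hpos x) (hb x) 2
  have h4 : a^2 * W x ^ 2 ≤ a^2 * N^2 := by gcongr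
  have h5 := le_abs_self E
  have h6 : |W1 x|^2 ≤ 2 * |E| + a^2 * N^2 := by rw [sq_abs]; linarith
  nlinarith [sq_nonneg (|W1 x| - 1), abs_nonneg (W1 x)]

open Filter Topology

lemma aux_E0 (p a E : ℝ) (hp : 1 < p) (ha : 0 < a) (W W1 : ℝ → ℝ) (hpos : ∀ x, 0 ≤ W x)
    (hW : ∀ x, HasDerivAt W (W1 x) x)
    (hW1 : ∀ x, HasDerivAt W1 (a^2 * W x - W x ^ p) x)
    (hZ : Integrable (fun x => (W1 x + a * tanh x * W x)^2))
    (hE : ∀ x, W1 x ^ 2 / 2 - a^2 / 2 * W x ^ 2 + W x ^ (p+1) / (p+1) = E) : E = 0 := by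
  obtain ⟨M, hM, hMW, hMW1⟩ := aux_bound p a E hp W W1 hpos hE
  have hWc : Continuous W := continuous_iff_continuousAt.2 fun x => (hW x).continuousAt
  have hW1c : Continuous W1 := continuous_iff_continuousAt.2 fun x => (hW1 x).continuousAt
  have hp1 : 0 < p + 1 := by linarith
  set Z := fun x => W1 x + a * tanh x * W x with hZdef
  set s := fun x => 1 - tanh x ^ 2 with hs
  have hs' : ∀ x, s x = 1 / cosh x ^ 2 := by
    intro x
    have := Real.cosh_sq x
    have hc := (Real.cosh_pos x).ne'
    simp only [hs, Real.tanh_eq_sinh_div_cosh]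
    field_simp; linarith
  have ht : ∀ x, HasDerivAt tanh (s x) x := by
    intro x
    have hc := (Real.cosh_pos x).ne'
    have h := (Real.hasDerivAt_sinh x).div (Real.hasDerivAt_cosh x) hc
    have e : tanh = sinh / cosh := by ext x; exact Real.tanh_eq_sinh_div_cosh x
    rw [e]
    refine h.congr_deriv ?_
    rw [hs']; congr 1; nlinarith [Real.cosh_sq x]
  have htc : Continuous tanh := continuous_iff_continuousAt.2 fun x => (ht x).continuousAt
  have hs0 : ∀ x, 0 ≤ s x := fun x => by rw [hs']; positivity
  have hs1 : ∀ x, s x ≤ 1 := fun x => by simp only [hs]; nlinarith [sq_nonneg (tanh x)]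
  have ht1 : ∀ x, |tanh x| ≤ 1 := fun x => by
    have := hs0 x
    simp only [hs] at this
    exact abs_le_one_iff_mul_self_le_one.2 (by nlinarith)
  set Z1 := fun x => (a^2 * W x - W x ^ p) + (a * s x * W x + a * tanh x * W1 x) with hZ1
  have hZd : ∀ x, HasDerivAt Z (Z1 x) x := fun x =>
    (hW1 x).add (((ht x).const_mul a).mul (hW x))
  have hsc : Continuous s := by fun_prop
  have hWp : Continuous fun x => W x ^ p := hWc.rpow_const (fun x => Or.inr (by linarith))
  have hZc : Continuous Z := by fun_prop
  have hZ1c : Continuous Z1 := by fun_prop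
  have hatW : ∀ x, |a * tanh x * W x| ≤ a * M := by
    intro x
    rw [abs_mul, abs_mul, abs_of_pos ha, abs_of_nonneg (hpos x), mul_assoc]
    have : |tanh x| * W x ≤ 1 * M := mul_le_mul (ht1 x) (hMW x) (hpos x) zero_le_one
    nlinarith
  have hatW1 : ∀ x, |a * tanh x * W1 x| ≤ a * M := by
    intro x
    rw [abs_mul, abs_mul, abs_of_pos ha, mul_assoc]
    have : |tanh x| * |W1 x| ≤ 1 * M := mul_le_mul (ht1 x) (hMW1 x) (abs_nonneg _) zero_le_one
    nlinarith
  have hZb : ∀ x, ‖Z x‖ ≤ M + a * M := by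
    intro x
    exact (abs_add_le _ _).trans (add_le_add (hMW1 x) (hatW x))
  have hZ1b : ∀ x, ‖Z1 x‖ ≤ (a^2 * M + M^p) + (a * M + a * M) := by
    intro x
    refine (abs_add_le _ _).trans (add_le_add ?_ ((abs_add_le _ _).trans (add_le_add ?_ (hatW1 x))))
    · refine (abs_sub _ _).trans (add_le_add ?_ ?_)
      · rw [abs_of_nonneg (mul_nonneg (sq_nonneg a) (hpos x))]
        have := hMW x
        gcongr
      · rw [abs_of_nonneg (Real.rpow_nonneg (hpos x) _)]
        exact Real.rpow_le_rpow (hpos x) (hMW x) (by linarith)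
    · rw [abs_of_nonneg (mul_nonneg (mul_nonneg ha.le (hs0 x)) (hpos x)), mul_assoc]
      have : s x * W x ≤ 1 * M := mul_le_mul (hs1 x) (hMW x) (hpos x) zero_le_one
      nlinarith
  have i1 : Integrable (fun x => Z x * Z x ^ 2) :=
    hZ.bdd_mul hZc.aestronglyMeasurable (Filter.Eventually.of_forall hZb)
  have i2 : Integrable (fun x => Z1 x * Z x ^ 2) :=
    hZ.bdd_mul hZ1c.aestronglyMeasurable (Filter.Eventually.of_forall hZ1b)
  have hZ3 : Tendsto (fun x => Z x ^ 3) atTop (𝓝 0) := by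
    refine tendsto_zero_of_hasDerivAt_of_integrableOn_Ioi (a := 0) (f' := fun x => 3 * (Z1 x * Z x ^ 2)) ?_ (i2.const_mul 3).integrableOn ?_
    · intro x _
      refine ((hZd x).pow 3).congr_deriv ?_
      norm_num; ring
    · have : (fun x => Z x ^ 3) = fun x => Z x * Z x ^ 2 := by ext x; ring
      rw [this]; exact i1.integrableOn
  have hZ0 : Tendsto Z atTop (𝓝 0) := by
    rw [Metric.tendsto_atTop] at hZ3 ⊢
    intro ε hε
    obtain ⟨N, hN⟩ := hZ3 (ε^3) (by positivity)
    refine ⟨N, fun n hn => ?_⟩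
    have := hN n hn
    rw [Real.dist_eq, sub_zero] at this ⊢
    rw [abs_pow] at this
    exact lt_of_pow_lt_pow_left₀ 3 hε.le this
  have hslim : Tendsto s atTop (𝓝 0) := by
    have h1 : Tendsto (fun x : ℝ => 2 * exp (-x)) atTop (𝓝 0) := by
      simpa using (Real.tendsto_exp_neg_atTop_nhds_zero).const_mul 2
    refine squeeze_zero hs0 (fun x => ?_) h1
    rw [hs', div_le_iff₀ (by positivity)]
    have h1 := Real.one_le_cosh x
    have h2 : exp x / 2 ≤ cosh x := by
      rw [Real.cosh_eq]; have := exp_pos (-x); linarith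
    have h3 : exp (-x) * exp x = 1 := by rw [← Real.exp_add]; simp
    have h4 : cosh x ≤ cosh x ^ 2 := by nlinarith
    have h5 := exp_pos (-x)
    nlinarith
  have hWp1 : Tendsto (fun x => W x ^ (p+1)) atTop (𝓝 ((p+1) * E)) := by
    have e : (fun x => W x ^ (p+1)) = fun x => (p+1) * (E - (Z x - 2 * (a * tanh x * W x)) * Z x / 2 + s x * W x ^ 2 * a ^ 2 / 2) := by
      ext x
      have : W x ^ (p+1) = (p+1) * (W x ^ (p+1) / (p+1)) := by field_simp
      rw [this]
      congr 1
      have := hE x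
      simp only [hZdef, hs]
      linarith
    rw [e]
    have t1 : Tendsto (fun x => (Z x - 2 * (a * tanh x * W x)) * Z x) atTop (𝓝 0) := by
      refine squeeze_zero_norm (a := fun x => (M + a * M + 2 * (a * M)) * |Z x|) (fun x => ?_) ?_
      · rw [norm_mul]
        refine mul_le_mul_of_nonneg_right ?_ (abs_nonneg _)
        refine (abs_sub _ _).trans (add_le_add (hZb x) ?_)
        rw [abs_mul, abs_two]; linarith [hatW x]
      · simpa using hZ0.abs.const_mul (M + a * M + 2 * (a * M))
    have t2 : Tendsto (fun x => s x * W x ^ 2) atTop (𝓝 0) := by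
      refine squeeze_zero (g := fun x => s x * M ^ 2) (fun x => mul_nonneg (hs0 x) (sq_nonneg _)) (fun x => ?_) ?_
      · exact mul_le_mul_of_nonneg_left (pow_le_pow_left₀ (hpos x) (hMW x) 2) (hs0 x)
      · simpa using hslim.mul_const (M^2)
    have := (((tendsto_const_nhds (x := E)).sub (t1.div_const 2)).add ((t2.mul_const (a^2)).div_const 2)).const_mul (p+1)
    simpa using this
  have hL : Tendsto W atTop (𝓝 (((p+1) * E) ^ (1/(p+1)))) := by
    have := hWp1.rpow_const (p := 1/(p+1)) (Or.inr (by positivity))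
    refine this.congr fun x => ?_
    rw [← Real.rpow_mul (hpos x), mul_one_div_cancel hp1.ne', Real.rpow_one]
  set L := ((p+1) * E) ^ (1/(p+1)) with hLdef
  have hW1sq : Tendsto (fun x => W1 x ^ 2) atTop (𝓝 (a^2 * L^2)) := by
    have := ((hL.pow 2).const_mul (a^2)).add (((tendsto_const_nhds (x := E)).sub (hWp1.div_const (p+1))).const_mul 2)
    have e : a ^ 2 * L ^ 2 + 2 * (E - (p + 1) * E / (p + 1)) = a^2 * L^2 := by
      field_simp; ring
    rw [e] at this
    refine this.congr fun x => ?_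
    have := hE x
    linarith
  have hmv : ∀ n : ℕ, ∃ c : ℝ, (n:ℝ) < c ∧ W1 c = W (n+1) - W n := by
    intro n
    obtain ⟨c, hc, h⟩ := exists_hasDerivAt_eq_slope W W1 (show (n:ℝ) < n + 1 by linarith)
      hWc.continuousOn (fun x _ => hW x)
    exact ⟨c, hc.1, by rw [h]; simp⟩
  choose c hc hc' using hmv
  have hcl : Tendsto c atTop atTop :=
    tendsto_atTop_mono (fun n => (hc n).le) tendsto_natCast_atTop_atTop
  have l1 := hW1sq.comp hcl
  have l2 : Tendsto (fun n => W1 (c n) ^ 2) atTop (𝓝 0) := by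
    have h1 : Tendsto (fun n : ℕ => W (n:ℝ)) atTop (𝓝 L) := hL.comp tendsto_natCast_atTop_atTop
    have h2 : Tendsto (fun n : ℕ => W ((n:ℝ)+1)) atTop (𝓝 L) :=
      hL.comp (tendsto_atTop_add_const_right _ _ tendsto_natCast_atTop_atTop)
    have := (h2.sub h1).pow 2
    simp only [hc']
    simpa using this
  have hL0 := tendsto_nhds_unique l1 l2
  have hL00 : L = 0 := by
    have : L^2 = 0 := by
      rcases mul_eq_zero.1 hL0 with h | h
      · exact absurd h (by positivity)
      · exact h
    exact pow_eq_zero_iff (two_ne_zero) |>.1 this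
  rw [hL00] at hL
  have h0 := hL.rpow_const (p := p+1) (Or.inr (by linarith))
  rw [Real.zero_rpow hp1.ne'] at h0
  have := tendsto_nhds_unique hWp1 h0
  rcases mul_eq_zero.1 this with h | h
  · linarith
  · exact h

lemma aux_zero (p a : ℝ) (hp : 1 < p) (ha : 0 < a) (W W1 : ℝ → ℝ) (hpos : ∀ x, 0 ≤ W x)
    (hW : ∀ x, HasDerivAt W (W1 x) x)
    (hE : ∀ x, W1 x ^ 2 / 2 - a^2 / 2 * W x ^ 2 + W x ^ (p+1) / (p+1) = 0) (x₀ : ℝ)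
    (h0 : W x₀ = 0) : ∀ x, W x = 0 := by
  have hb : ∀ x, |W1 x| ≤ a * W x := by
    intro x
    have h2 : 0 ≤ W x ^ (p+1) / (p+1) := div_nonneg (Real.rpow_nonneg (hpos x) _) (by linarith)
    have := hE x
    exact abs_le_of_sq_le_sq (by nlinarith) (mul_nonneg ha.le (hpos x))
  have d1 : ∀ x, HasDerivAt (fun x => W x * exp (a * x)) (W1 x * exp (a*x) + W x * (exp (a*x) * (a * 1))) x :=
    fun x => (hW x).mul (((hasDerivAt_id x).const_mul a).exp)
  have d2 : ∀ x, HasDerivAt (fun x => W x * exp (-a * x)) (W1 x * exp (-a*x) + W x * (exp (-a*x) * (-a * 1))) x :=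
    fun x => (hW x).mul (((hasDerivAt_id x).const_mul (-a)).exp)
  have m1 : Monotone (fun x => W x * exp (a * x)) := by
    refine monotone_of_deriv_nonneg (fun x => (d1 x).differentiableAt) fun x => ?_
    rw [(d1 x).deriv]
    have := (abs_le.1 (hb x)).1
    have h3 := exp_pos (a*x)
    nlinarith
  have m2 : Antitone (fun x => W x * exp (-a * x)) := by
    refine antitone_of_deriv_nonpos (fun x => (d2 x).differentiableAt) fun x => ?_
    rw [(d2 x).deriv]
    have := (abs_le.1 (hb x)).2
    have h3 := exp_pos (-a*x)
    nlinarith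
  intro x
  refine le_antisymm ?_ (hpos x)
  rcases le_total x x₀ with h | h
  · have := m1 h
    simp only [h0, zero_mul] at this
    by_contra! hc
    have := mul_pos hc (exp_pos (a*x))
    linarith
  · have := m2 h
    simp only [h0, zero_mul] at this
    by_contra! hc
    have := mul_pos hc (exp_pos (-a*x))
    linarith

lemma aux_pos (p a : ℝ) (hp : 1 < p) (ha : a = 2/(p-1)) (W W1 : ℝ → ℝ) (hpos : ∀ x, 0 < W x)
    (hW : ∀ x, HasDerivAt W (W1 x) x)
    (hW1 : ∀ x, HasDerivAt W1 (a^2 * W x - W x ^ p) x)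
    (hE : ∀ x, W1 x ^ 2 / 2 - a^2 / 2 * W x ^ 2 + W x ^ (p+1) / (p+1) = 0) :
    ∃ A d : ℝ, 0 < A ∧ d ∈ Ioo (-1:ℝ) 1 ∧ A^2 * (1 - d^2) = (p-1)^2/(2*(p+1)) ∧
      ∀ x, W x = (A * (cosh x + d * sinh x)) ^ (-a) := by
  have hp1 : 0 < p - 1 := by linarith
  have hp2 : 0 < p + 1 := by linarith
  have hwp : ∀ x, W x ^ (p+1) = W x ^ (p-1) * W x ^ 2 := by
    intro x
    rw [← Real.rpow_natCast, ← Real.rpow_add (hpos x)]; norm_num; ring_nf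
  have hwp' : ∀ x, W x ^ p = W x ^ (p-1) * W x := by
    intro x
    rw [← Real.rpow_add_one (hpos x).ne']; ring_nf
  set b := (p-1)/2 with hb
  set V := fun x => W x ^ (-b) with hV
  set V1 := fun x => W1 x * (-b) * W x ^ (-b-1) with hV1
  have hVpos : ∀ x, 0 < V x := fun x => Real.rpow_pos_of_pos (hpos x) _
  have hVW : ∀ x, V x ^ 2 * W x ^ (p-1) = 1 := by
    intro x
    simp only [hV]
    rw [← Real.rpow_natCast, ← Real.rpow_mul (hpos x).le, ← Real.rpow_add (hpos x)]
    rw [hb]; norm_num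
  have e1 : ∀ x, W x ^ (-b-1) = V x / W x := fun x => Real.rpow_sub_one (hpos x).ne' _
  have e2 : ∀ x, W x ^ (-b-1-1) = V x / W x / W x := fun x => by
    rw [Real.rpow_sub_one (hpos x).ne', e1]
  have dV : ∀ x, HasDerivAt V (V1 x) x := fun x => (hW x).rpow_const (Or.inl (hpos x).ne')
  have hsq : ∀ x, W1 x ^ 2 = (a^2 - 2/(p+1) * W x ^ (p-1)) * W x ^ 2 := by
    intro x
    have := hE x
    rw [hwp] at this
    have h2 : W x ^ (p - 1) * W x ^ 2 / (p + 1) = 1/(p+1) * W x ^ (p-1) * W x ^2 := by ring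
    rw [h2] at this
    linear_combination 2 * this
  have hab : a * b = 1 := by rw [ha, hb]; field_simp
  have hb2 : b + 1 = (p+1)/2 := by rw [hb]; ring
  have dV1 : ∀ x, HasDerivAt V1 (V x) x := by
    intro x
    have h := ((hW1 x).mul_const (-b)).mul ((hW x).rpow_const (p := -b-1) (Or.inl (hpos x).ne'))
    refine h.congr_deriv ?_
    rw [e1, e2, hwp']
    have hx := (hpos x).ne'
    have : (a ^ 2 * W x - W x ^ (p - 1) * W x) * -b * (V x / W x) + W1 x * -b * (W1 x * (-b - 1) * (V x / W x / W x))
      = V x * (-(a^2 - W x ^ (p-1)) * b + b * (b+1) * (W1 x ^ 2 / W x ^ 2)) := by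
      field_simp; ring
    rw [this, hsq, mul_div_assoc, div_self (by positivity)]
    have h3 : (b+1) * (2/(p+1)) = 1 := by rw [hb2]; field_simp
    linear_combination V x * (a*b+1) * hab - V x * b * W x ^ (p-1) * h3
  have hinv : ∀ x, V x ^ 2 - V1 x ^ 2 = (p-1)^2/(2*(p+1)) := by
    intro x
    have hx := (hpos x).ne'
    have : V1 x ^ 2 = b^2 * V x ^ 2 * (W1 x ^ 2 / W x ^ 2) := by
      simp only [hV1, e1]; field_simp
    rw [this, hsq, mul_div_assoc, div_self (by positivity)]
    have h4 : (p-1)^2/(2*(p+1)) = b^2 * (2/(p+1)) := by rw [hb]; field_simp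
    rw [h4]
    linear_combination -V x ^ 2 * (a*b+1) * hab + b^2 * (2/(p+1)) * hVW x
  have c1 : ∀ x, (V1 x + V x) * exp (-x) = V1 0 + V 0 := by
    have k : ∀ x, HasDerivAt (fun x => (V1 x + V x) * exp (-x)) 0 x := by
      intro x
      refine (((dV1 x).add (dV x)).mul ((hasDerivAt_id x).neg.exp)).congr_deriv ?_
      simp; ring
    intro x
    have := is_const_of_deriv_eq_zero (fun x => (k x).differentiableAt) (fun x => (k x).deriv) x 0
    simpa using this
  have c2 : ∀ x, (V1 x - V x) * exp x = V1 0 - V 0 := by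
    have k : ∀ x, HasDerivAt (fun x => (V1 x - V x) * exp x) 0 x := by
      intro x
      refine (((dV1 x).sub (dV x)).mul (Real.hasDerivAt_exp x)).congr_deriv ?_
      simp; ring
    intro x
    have := is_const_of_deriv_eq_zero (fun x => (k x).differentiableAt) (fun x => (k x).deriv) x 0
    simpa using this
  have hsol : ∀ x, V x = V 0 * cosh x + V1 0 * sinh x := by
    intro x
    have h1 := c1 x
    have h2 := c2 x
    have h3 : exp (-x) * exp x = 1 := by rw [← Real.exp_add]; simp
    rw [Real.cosh_eq, Real.sinh_eq]
    linear_combination (-V x) * h3 + (exp x)/2 * h1 - exp (-x)/2 * h2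
  have hV0 := hVpos 0
  have hi := hinv 0
  have hcpos : 0 < (p-1)^2/(2*(p+1)) := by positivity
  refine ⟨V 0, V1 0 / V 0, hV0, ?_, ?_, ?_⟩
  · have : |V1 0| < V 0 := abs_lt_of_sq_lt_sq (by linarith) hV0.le
    have := abs_lt.1 this
    exact ⟨by rw [lt_div_iff₀ hV0]; linarith, by rw [div_lt_iff₀ hV0]; linarith⟩
  · rw [← hi]; field_simp
  · intro x
    have : V 0 * (cosh x + V1 0 / V 0 * sinh x) = V x := by
      rw [hsol x]; field_simp
    rw [this]
    simp only [hV]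
    rw [← Real.rpow_mul (hpos x).le]
    have : -b * -a = 1 := by linarith
    rw [this, Real.rpow_one]

lemma aux_tanh_deriv (x : ℝ) : HasDerivAt tanh (1 - tanh x ^ 2) x := by
  have hc := (Real.cosh_pos x).ne'
  have h := (Real.hasDerivAt_sinh x).div (Real.hasDerivAt_cosh x) hc
  have e : tanh = sinh / cosh := by ext x; exact Real.tanh_eq_sinh_div_cosh x
  have e2 := Real.tanh_eq_sinh_div_cosh x
  rw [e2, e]
  refine h.congr_deriv ?_
  field_simp

lemma aux_sech (x : ℝ) : 1 - tanh x ^ 2 = cosh x ^ (-2 : ℝ) := by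
  have := Real.cosh_sq x
  have hc := (Real.cosh_pos x)
  rw [Real.rpow_neg hc.le, Real.tanh_eq_sinh_div_cosh]
  norm_num
  field_simp; linarith

theorem nonneg_stationary_classification (p : ℝ) (hp : 1 < p) (w : ℝ → ℝ)
    (hreg : ContDiffOn ℝ 2 w (Ioo (-1:ℝ) 1))
    (hODE : ∀ y ∈ Ioo (-1:ℝ) 1,
      (1 - y^2) * deriv (deriv w) y - (2*(p+1)/(p-1)) * y * deriv w y
        - (2*(p+1)/(p-1)^2) * w y + w y ^ p = 0)
    (hpos : ∀ y ∈ Ioo (-1:ℝ) 1, 0 ≤ w y)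
    (hnorm : IntegrableOn
      (fun y => ((deriv w y)^2 * (1 - y^2) + (w y)^2) * (1 - y^2) ^ (2/(p-1)))
      (Ioo (-1:ℝ) 1)) :
    (∀ y ∈ Ioo (-1:ℝ) 1, w y = 0) ∨
    (∃ d ∈ Ioo (-1:ℝ) 1, ∀ y ∈ Ioo (-1:ℝ) 1,
      w y = (2*(p+1)/(p-1)^2) ^ (1/(p-1)) * (1-d^2) ^ (1/(p-1)) *
        (1+d*y) ^ (-(2/(p-1)))) := by
  have hp1 : 0 < p - 1 := by linarith
  have hp2 : 0 < p + 1 := by linarith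
  set a := 2/(p-1) with ha
  have ha0 : 0 < a := by positivity
  have hap : a * (p - 1) = 2 := by rw [ha]; field_simp
  have htm : ∀ x : ℝ, tanh x ∈ Ioo (-1:ℝ) 1 := fun x => Real.tanh_bijOn.mapsTo (mem_univ x)
  have hd1 : ∀ y ∈ Ioo (-1:ℝ) 1, HasDerivAt w (deriv w y) y := fun y hy =>
    ((hreg.differentiableOn (by norm_num)).differentiableAt (isOpen_Ioo.mem_nhds hy)).hasDerivAt
  have hd2 : ∀ y ∈ Ioo (-1:ℝ) 1, HasDerivAt (deriv w) (deriv (deriv w) y) y := fun y hy => by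
    have h := ((contDiffOn_succ_iff_deriv_of_isOpen (n := 1) isOpen_Ioo).1 (by rw [one_add_one_eq_two]; exact hreg)).2.2
    exact ((h.differentiableOn (by norm_num)).differentiableAt (isOpen_Ioo.mem_nhds hy)).hasDerivAt
  set W := fun x => cosh x ^ (-a) * w (tanh x) with hWdef
  set W1 := fun x => cosh x ^ (-a) * ((1 - tanh x ^ 2) * deriv w (tanh x) - a * tanh x * w (tanh x)) with hW1def
  have hc : ∀ x, HasDerivAt (fun x => cosh x ^ (-a)) (cosh x ^ (-a) * (- a * tanh x)) x := by
    intro x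
    refine ((Real.hasDerivAt_cosh x).rpow_const (p := -a) (Or.inl (Real.cosh_pos x).ne')).congr_deriv ?_
    rw [Real.rpow_sub_one (Real.cosh_pos x).ne', Real.tanh_eq_sinh_div_cosh]
    ring
  have hwt : ∀ x, HasDerivAt (fun x => w (tanh x)) (deriv w (tanh x) * (1 - tanh x ^ 2)) x :=
    fun x => (hd1 _ (htm x)).comp x (aux_tanh_deriv x)
  have hwt2 : ∀ x, HasDerivAt (fun x => deriv w (tanh x)) (deriv (deriv w) (tanh x) * (1 - tanh x ^ 2)) x :=
    fun x => (hd2 _ (htm x)).comp x (aux_tanh_deriv x)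
  have hWpos : ∀ x, 0 ≤ W x := fun x =>
    mul_nonneg (Real.rpow_nonneg (Real.cosh_pos x).le _) (hpos _ (htm x))
  have hW : ∀ x, HasDerivAt W (W1 x) x := by
    intro x
    refine ((hc x).mul (hwt x)).congr_deriv ?_
    simp only [hW1def]; ring
  have hWp : ∀ x, W x ^ p = cosh x ^ (-a) * (1 - tanh x ^ 2) * w (tanh x) ^ p := by
    intro x
    have hcp := Real.cosh_pos x
    simp only [hWdef]
    rw [Real.mul_rpow (Real.rpow_nonneg hcp.le _) (hpos _ (htm x)), aux_sech,
      ← Real.rpow_mul hcp.le, ← Real.rpow_add hcp]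
    congr 2
    linarith
  have hW1 : ∀ x, HasDerivAt W1 (a^2 * W x - W x ^ p) x := by
    intro x
    have ht := aux_tanh_deriv x
    refine ((hc x).mul ((((ht.pow 2).const_sub 1).mul (hwt2 x)).sub ((ht.const_mul a).mul (hwt x)))).congr_deriv ?_
    rw [hWp]
    simp only [hWdef]
    have ho := hODE _ (htm x)
    have e1 : 2*(p+1)/(p-1) = 2*a + 2 := by rw [ha]; field_simp; ring
    have e2 : 2*(p+1)/(p-1)^2 = a^2 + a := by rw [ha]; field_simp; ring
    rw [e1, e2] at ho
    simp only [Nat.cast_ofNat, Pi.pow_apply, Pi.sub_apply, Pi.mul_apply]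
    linear_combination cosh x ^ (-a) * (1 - tanh x ^ 2) * ho
  have hZ : Integrable (fun x => (W1 x + a * tanh x * W x)^2) := by
    have g : IntegrableOn (fun y => (deriv w y)^2 * (1 - y^2) * (1 - y^2) ^ a) (Ioo (-1:ℝ) 1) := by
      refine Integrable.mono' hnorm ?_ ?_
      · have := measurable_deriv w
        exact Measurable.aestronglyMeasurable (by fun_prop)
      · refine (ae_restrict_iff' measurableSet_Ioo).2 (Filter.Eventually.of_forall fun y hy => ?_)
        have h1 : 0 < 1 - y^2 := by nlinarith [hy.1, hy.2]
        have h2 : 0 < (1 - y^2)^a := Real.rpow_pos_of_pos h1 _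
        rw [Real.norm_of_nonneg (by positivity)]
        have := sq_nonneg (w y)
        gcongr
        linarith
    have him : tanh '' univ = Ioo (-1:ℝ) 1 := Real.tanh_bijOn.image_eq
    rw [← him, integrableOn_image_iff_integrableOn_abs_deriv_smul MeasurableSet.univ
      (fun x _ => (aux_tanh_deriv x).hasDerivWithinAt) Real.tanh_injective.injOn, integrableOn_univ] at g
    refine g.congr (Filter.Eventually.of_forall fun x => ?_)
    have hcp := Real.cosh_pos x
    have hs : 0 < 1 - tanh x ^ 2 := by rw [aux_sech]; positivity
    have hca : (1 - tanh x ^ 2) ^ a = (cosh x ^ (-a))^2 := by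
      rw [aux_sech, ← Real.rpow_mul hcp.le, ← Real.rpow_natCast, ← Real.rpow_mul hcp.le]
      congr 1; push_cast; ring
    simp only [smul_eq_mul, abs_of_pos hs, hca, hW1def, hWdef]
    ring
  obtain ⟨E, hE⟩ := aux_energy p a hp W W1 hW hW1
  have hE0 := aux_E0 p a E hp ha0 W W1 hWpos hW hW1 hZ hE
  rw [hE0] at hE
  by_cases hz : ∃ x₀, W x₀ = 0
  · left
    obtain ⟨x₀, h0⟩ := hz
    have hall := aux_zero p a hp ha0 W W1 hWpos hW hE x₀ h0
    intro y hy
    have h := hall (artanh y)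
    simp only [hWdef, Real.tanh_artanh hy] at h
    exact (mul_eq_zero.1 h).resolve_left (Real.rpow_pos_of_pos (Real.cosh_pos _) _).ne'
  · right
    have hWp' : ∀ x, 0 < W x := fun x => lt_of_le_of_ne (hWpos x) fun h => hz ⟨x, h.symm⟩
    obtain ⟨A, d, hA, hd, hAd, hsol⟩ := aux_pos p a hp ha W W1 hWp' hW hW1 hE
    refine ⟨d, hd, fun y hy => ?_⟩
    have h := hsol (artanh y)
    have hcp := Real.cosh_pos (artanh y)
    have hsh : sinh (artanh y) = y * cosh (artanh y) := by
      have := Real.tanh_eq_sinh_div_cosh (artanh y)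
      rw [Real.tanh_artanh hy] at this
      field_simp at this
      linarith
    have h1dy : 0 < 1 + d * y := by
      have : |d * y| < 1 := by
        rw [abs_mul]
        have h1 := abs_lt.2 hd
        have h2 := abs_lt.2 hy
        nlinarith [abs_nonneg d, abs_nonneg y]
      linarith [(abs_lt.1 this).1]
    have e : A * (cosh (artanh y) + d * sinh (artanh y)) = cosh (artanh y) * (A * (1 + d * y)) := by
      rw [hsh]; ring
    simp only [hWdef, Real.tanh_artanh hy] at h
    rw [e, Real.mul_rpow hcp.le (by positivity)] at h
    have h' := mul_left_cancel₀ (Real.rpow_pos_of_pos hcp _).ne' h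
    rw [h', Real.mul_rpow hA.le h1dy.le]
    congr 1
    have hd1 : 0 < 1 - d^2 := by nlinarith [hd.1, hd.2]
    rw [← Real.mul_rpow (by positivity) hd1.le]
    have : 2 * (p+1)/(p-1)^2 * (1 - d^2) = A ^ (-2:ℝ) := by
      rw [Real.rpow_neg hA.le]
      norm_num
      refine eq_inv_of_mul_eq_one_left ?_
      have : A^2 * (1 - d^2) * (2*(p+1)/(p-1)^2) = 1 := by rw [hAd]; field_simp
      linarith
    rw [this, ← Real.rpow_mul hA.le]
    congr 1
    rw [ha]; ring
end

section
/- Fix p > 1. There exists a constant C = C(p) > 0 such that for every locally absolutely continuous h : (−1,1) → ℝ with ‖h‖²_{H₀} = ∫_{−1}^{1} (h'(y)² (1−y²) + h(y)²) ρ(y) dy < ∞, the following three bounds hold: (∫_{−1}^{1} h(y)² ρ(y)/(1−y²) dy)^{1/2} ≤ C ‖h‖_{H₀}; (∫_{−1}^{1} |h(y)|^{p+1} ρ(y) dy)^{1/(p+1)} ≤ C ‖h‖_{H₀}; and sup_{y ∈ (−1,1)} |h(y)| (1−y²)^{1/(p−1)} ≤ C ‖h‖_{H₀}. -/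
open Real MeasureTheory Set

lemma hs_w_pos {y : ℝ} (hy : y ∈ Ioo (-1:ℝ) 1) : 0 < 1 - y^2 := by
  nlinarith [hy.1, hy.2]

lemma hs_W_deriv (α : ℝ) {y : ℝ} (hy : y ∈ Ioo (-1:ℝ) 1) :
    HasDerivAt (fun y : ℝ => (1 - y^2)^α) (-2*y*α*((1 - y^2)^α/(1-y^2))) y := by
  have hw := hs_w_pos hy
  have h1 : HasDerivAt (fun y : ℝ => 1 - y^2) (-2*y) y := by
    have := (hasDerivAt_pow 2 y).const_sub 1
    exact this.congr_deriv (by norm_num)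
  have := h1.rpow_const (p := α) (Or.inl hw.ne')
  rwa [Real.rpow_sub_one hw.ne'] at this

lemma hs_pt1 {α w y h d W : ℝ} (ha : 0 < α) (hw : 0 < w) (hy : w = 1 - y^2) (hW : 0 < W) :
    1 * (h^2 * W) + y * (2*h*d*W + h^2 * (-2*y*α*(W/w))) ≤
      (1 + 2*α + 1/α) * ((d^2*w + h^2)*W) - α * (h^2*W/w) := by
  have e1 : 2*(y*(h*d)) ≤ α*(h^2/w) + 1/α*(d^2*w) := by
    have : α*(h^2/w) + 1/α*(d^2*w) - 2*(y*(h*d)) =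
        (α*h - y*(d*w))^2/(α*w) + (1-y^2)*d^2*w/α := by
      field_simp; ring
    have h2 : 0 ≤ (α*h - y*(d*w))^2/(α*w) + (1-y^2)*d^2*w/α := by
      rw [← hy]; positivity
    linarith
  have e2 : y^2*(h^2/w) = h^2/w - h^2 := by
    have : y^2 = 1 - w := by linarith
    rw [this]; field_simp
  have key : h^2 + 2*(y*(h*d)) - 2*α*(y^2*(h^2/w)) ≤
      (1 + 2*α + 1/α) * (d^2*w + h^2) - α * (h^2/w) := by
    rw [e2]
    have : 0 ≤ (1+2*α)*(d^2*w) + 1/α*h^2 := by positivity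
    nlinarith
  have := mul_le_mul_of_nonneg_right key hW.le
  calc _ = (h^2 + 2*(y*(h*d)) - 2*α*(y^2*(h^2/w))) * W := by ring
    _ ≤ _ := this
    _ = _ := by ring

lemma hs_pt2 {α w y h d W : ℝ} (ha : 0 < α) (hw : 0 < w) (hy : w = 1 - y^2) (hW : 0 < W) :
    |2*h*d*W + h^2 * (-2*y*α*(W/w))| ≤
      (d^2*w + h^2)*W + (1+2*α) * (h^2*W/w) := by
  have hy1 : |y| ≤ 1 := by
    rw [← sq_le_one_iff_abs_le_one]; linarith
  have e1 : 2*|h*d| ≤ h^2/w + d^2*w := by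
    have : h^2/w + d^2*w - 2*|h*d| = (|h| - |d| * w)^2/w := by
      rw [abs_mul, ← sq_abs h, ← sq_abs d]; field_simp; ring
    have h2 : 0 ≤ (|h| - |d| * w)^2/w := by positivity
    linarith
  have e3 : 0 ≤ h^2*W/w := by positivity
  calc |2*h*d*W + h^2 * (-2*y*α*(W/w))| ≤ |2*h*d*W| + |h^2 * (-2*y*α*(W/w))| := abs_add_le _ _
    _ = 2*|h*d| * W + |y| * (2*α*(h^2*W/w)) := by
        congr 1
        · rw [show 2*h*d*W = 2*(h*d)*W by ring, abs_mul, abs_mul, abs_of_pos hW, abs_two]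
        · rw [show h^2 * (-2*y*α*(W/w)) = -(y * (2*α*(h^2*W/w))) by ring, abs_neg, abs_mul,
            abs_of_nonneg (a := 2*α*(h^2*W/w)) (by positivity)]
    _ ≤ (h^2/w + d^2*w)*W + 1*(2*α*(h^2*W/w)) := by gcongr
    _ ≤ _ := by
        have : 0 ≤ h^2*W := by positivity
        have e : h^2/w*W = h^2*W/w := by ring
        nlinarith

section
variable {α : ℝ} {h : ℝ → ℝ}

lemma hs_q_cont (hd : DifferentiableOn ℝ h (Ioo (-1:ℝ) 1)) :
    ContinuousOn (fun y => (h y)^2 * (1 - y^2)^α / (1 - y^2)) (Ioo (-1:ℝ) 1) := by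
  refine ContinuousOn.div (ContinuousOn.mul (hd.continuousOn.pow 2) ?_) (by fun_prop)
    (fun y hy => (hs_w_pos hy).ne')
  exact fun y hy => (hs_W_deriv α hy).continuousAt.continuousWithinAt

lemma hs_F2_deriv (hd : DifferentiableOn ℝ h (Ioo (-1:ℝ) 1)) {y : ℝ} (hy : y ∈ Ioo (-1:ℝ) 1) :
    HasDerivAt (fun y => (h y)^2 * (1 - y^2)^α)
      (2*h y*deriv h y*(1-y^2)^α + (h y)^2 * (-2*y*α*((1-y^2)^α/(1-y^2)))) y := by
  have h1 := (hd.differentiableAt (isOpen_Ioo.mem_nhds hy)).hasDerivAt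
  have := (h1.pow 2).mul (hs_W_deriv α hy)
  exact this.congr_deriv (by norm_num)

lemma hs_hardy (ha : 0 < α) (hd : DifferentiableOn ℝ h (Ioo (-1:ℝ) 1))
    (hf : IntegrableOn (fun y => ((deriv h y)^2 * (1 - y^2) + (h y)^2) * (1 - y^2)^α)
      (Ioo (-1:ℝ) 1)) :
    IntegrableOn (fun y => (h y)^2 * (1 - y^2)^α / (1 - y^2)) (Ioo (-1:ℝ) 1) ∧
    ∫ y in Ioo (-1:ℝ) 1, (h y)^2 * (1 - y^2)^α / (1 - y^2) ≤ (1 + 2*α + 1/α)/α *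
      ∫ y in Ioo (-1:ℝ) 1, ((deriv h y)^2 * (1 - y^2) + (h y)^2) * (1 - y^2)^α := by
  set f := fun y => ((deriv h y)^2 * (1 - y^2) + (h y)^2) * (1 - y^2)^α with hfdef
  set q := fun y => (h y)^2 * (1 - y^2)^α / (1 - y^2) with hqdef
  set K := 1 + 2*α + 1/α with hK
  have hKpos : 0 < K := by positivity
  have hf0 : ∀ y ∈ Ioo (-1:ℝ) 1, 0 ≤ f y := fun y hy => by
    have := hs_w_pos hy
    simp only [hfdef]; positivity
  have hq0 : ∀ y ∈ Ioo (-1:ℝ) 1, 0 ≤ q y := fun y hy => by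
    have := hs_w_pos hy
    simp only [hqdef]; positivity
  have sub : ∀ r : ℝ, r < 1 → Icc (-r) r ⊆ Ioo (-1:ℝ) 1 := fun r hr y hy =>
    ⟨by linarith [hy.1], by linarith [hy.2]⟩
  have qi : ∀ r : ℝ, r < 1 → IntegrableOn q (Icc (-r) r) := fun r hr =>
    ((hs_q_cont hd).mono (sub r hr)).integrableOn_Icc
  have bound : ∀ r : ℝ, 0 ≤ r → r < 1 →
      ∫ y in Icc (-r) r, q y ≤ K/α * ∫ y in Ioo (-1:ℝ) 1, f y := by
    intro r hr0 hr
    have hr' : -r ≤ r := by linarith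
    have hder : ∀ y ∈ Ioo (-1:ℝ) 1, HasDerivAt (fun y => y * ((h y)^2 * (1 - y^2)^α))
        (1 * ((h y)^2 * (1 - y^2)^α) + y * (2*h y*deriv h y*(1-y^2)^α +
          (h y)^2 * (-2*y*α*((1-y^2)^α/(1-y^2))))) y := fun y hy =>
      (hasDerivAt_id y).mul (hs_F2_deriv hd hy)
    have fi : IntegrableOn f (Icc (-r) r) := hf.mono_set (sub r hr)
    have := intervalIntegral.sub_le_integral_of_hasDeriv_right_of_le (φ := fun y => K * f y - α * q y) hr'
      (fun y hy => (hder y (sub r hr hy)).continuousAt.continuousWithinAt)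
      (fun y hy => (hder y (sub r hr (Ioo_subset_Icc_self hy))).hasDerivWithinAt)
      ((fi.const_mul K).sub ((qi r hr).const_mul α))
      (fun y hy => hs_pt1 ha (hs_w_pos (sub r hr (Ioo_subset_Icc_self hy))) rfl
        (Real.rpow_pos_of_pos (hs_w_pos (sub r hr (Ioo_subset_Icc_self hy))) α))
    rw [intervalIntegral.integral_of_le hr', ← integral_Icc_eq_integral_Ioc,
      integral_sub (fi.const_mul K) ((qi r hr).const_mul α), integral_const_mul,
      integral_const_mul] at this
    have hw : 0 < 1 - r^2 := by nlinarith
    have p1 : 0 ≤ r * ((h r)^2 * (1 - r^2)^α) := by positivity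
    have p2 : 0 ≤ r * ((h (-r))^2 * (1 - (-r)^2)^α) := by
      rw [neg_sq]; positivity
    have p3 : ∫ y in Icc (-r) r, f y ≤ ∫ y in Ioo (-1:ℝ) 1, f y :=
      setIntegral_mono_set hf ((ae_restrict_mem measurableSet_Ioo).mono hf0)
        (sub r hr).eventuallyLE
    have p4 := mul_le_mul_of_nonneg_left p3 hKpos.le
    rw [div_mul_eq_mul_div, le_div_iff₀ ha]
    linarith
  have hr : ∀ n : ℕ, (0:ℝ) ≤ 1 - 1/((n:ℝ)+1) ∧ 1 - 1/((n:ℝ)+1) < 1 := fun n => by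
    have h1 : (0:ℝ) < 1/((n:ℝ)+1) := by positivity
    have h2 : 1/((n:ℝ)+1) ≤ 1 := by
      rw [div_le_one (by positivity)]; linarith [n.cast_nonneg (α := ℝ)]
    constructor <;> linarith
  have ht : Filter.Tendsto (fun n : ℕ => 1 - 1/((n:ℝ)+1)) Filter.atTop (nhds 1) := by
    simpa using (tendsto_one_div_add_atTop_nhds_zero_nat (𝕜 := ℝ)).const_sub 1
  have hcov := aecover_Ioo_of_Icc (μ := volume) ht.neg ht
  have hres : ∀ n : ℕ, (volume.restrict (Ioo (-1:ℝ) 1)).restrict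
      (Icc (-(1 - 1/((n:ℝ)+1))) (1 - 1/((n:ℝ)+1))) =
      volume.restrict (Icc (-(1 - 1/((n:ℝ)+1))) (1 - 1/((n:ℝ)+1))) := fun n => by
    rw [Measure.restrict_restrict measurableSet_Icc, inter_eq_left.mpr (sub _ (hr n).2)]
  have hI : IntegrableOn q (Ioo (-1:ℝ) 1) := by
    refine hcov.integrable_of_integral_bounded_of_nonneg_ae (K/α * ∫ y in Ioo (-1:ℝ) 1, f y)
      (fun n => ?_) ((ae_restrict_mem measurableSet_Ioo).mono hq0)
      (Filter.Eventually.of_forall fun n => ?_)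
    · rw [IntegrableOn, hres]; exact qi _ (hr n).2
    · rw [hres]; exact bound _ (hr n).1 (hr n).2
  refine ⟨hI, le_of_tendsto (hcov.integral_tendsto_of_countably_generated hI)
    (Filter.Eventually.of_forall fun n => ?_)⟩
  rw [hres]; exact bound _ (hr n).1 (hr n).2

lemma hs_sup (ha : 0 < α) (hd : DifferentiableOn ℝ h (Ioo (-1:ℝ) 1))
    (hf : IntegrableOn (fun y => ((deriv h y)^2 * (1 - y^2) + (h y)^2) * (1 - y^2)^α)
      (Ioo (-1:ℝ) 1))
    (hq : IntegrableOn (fun y => (h y)^2 * (1 - y^2)^α / (1 - y^2)) (Ioo (-1:ℝ) 1))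
    {x y : ℝ} (hx : x ∈ Ioo (-1:ℝ) 1) (hy : y ∈ Ioo (-1:ℝ) 1) :
    (h y)^2 * (1 - y^2)^α ≤ (h x)^2 * (1 - x^2)^α +
      ((∫ y in Ioo (-1:ℝ) 1, ((deriv h y)^2 * (1 - y^2) + (h y)^2) * (1 - y^2)^α) +
      (1+2*α) * ∫ y in Ioo (-1:ℝ) 1, (h y)^2 * (1 - y^2)^α / (1 - y^2)) := by
  set f := fun y => ((deriv h y)^2 * (1 - y^2) + (h y)^2) * (1 - y^2)^α with hfdef
  set q := fun y => (h y)^2 * (1 - y^2)^α / (1 - y^2) with hqdef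
  have hφ : IntegrableOn (fun y => f y + (1+2*α) * q y) (Ioo (-1:ℝ) 1) :=
    hf.add (hq.const_mul _)
  have hφ0 : ∀ y ∈ Ioo (-1:ℝ) 1, 0 ≤ f y + (1+2*α) * q y := fun y hy => by
    have := hs_w_pos hy
    simp only [hfdef, hqdef]; positivity
  have hM : (∫ y in Ioo (-1:ℝ) 1, f y) + (1+2*α) * ∫ y in Ioo (-1:ℝ) 1, q y =
      ∫ y in Ioo (-1:ℝ) 1, (f y + (1+2*α) * q y) := by
    rw [integral_add hf (hq.const_mul _), integral_const_mul]
  rw [hM]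
  have mono : ∀ a b : ℝ, a ∈ Ioo (-1:ℝ) 1 → b ∈ Ioo (-1:ℝ) 1 → a ≤ b →
      ∫ y in a..b, (f y + (1+2*α) * q y) ≤ ∫ y in Ioo (-1:ℝ) 1, (f y + (1+2*α) * q y) := by
    intro a b ha' hb hab
    rw [intervalIntegral.integral_of_le hab]
    refine setIntegral_mono_set hφ ((ae_restrict_mem measurableSet_Ioo).mono hφ0)
      (LE.le.eventuallyLE ?_)
    intro y hy
    exact ⟨ha'.1.trans hy.1, hy.2.trans_lt hb.2⟩
  have sub : ∀ a b : ℝ, a ∈ Ioo (-1:ℝ) 1 → b ∈ Ioo (-1:ℝ) 1 → Icc a b ⊆ Ioo (-1:ℝ) 1 :=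
    fun a b ha' hb y hy => ⟨ha'.1.trans_le hy.1, hy.2.trans_lt hb.2⟩
  rcases le_total x y with hxy | hxy
  · have := intervalIntegral.sub_le_integral_of_hasDeriv_right_of_le
      (φ := fun y => f y + (1+2*α) * q y) hxy
      (fun z hz => (hs_F2_deriv (α := α) hd (sub x y hx hy hz)).continuousAt.continuousWithinAt)
      (fun z hz => (hs_F2_deriv hd (sub x y hx hy (Ioo_subset_Icc_self hz))).hasDerivWithinAt)
      (hφ.mono_set (sub x y hx hy))
      (fun z hz => (le_abs_self _).trans
        (hs_pt2 ha (hs_w_pos (sub x y hx hy (Ioo_subset_Icc_self hz))) rfl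
        (Real.rpow_pos_of_pos (hs_w_pos (sub x y hx hy (Ioo_subset_Icc_self hz))) α)))
    linarith [mono x y hx hy hxy]
  · have := intervalIntegral.sub_le_integral_of_hasDeriv_right_of_le
      (φ := fun y => f y + (1+2*α) * q y) hxy
      (fun z hz => (hs_F2_deriv (α := α) hd (sub y x hy hx hz)).neg.continuousAt.continuousWithinAt)
      (fun z hz => (hs_F2_deriv hd (sub y x hy hx (Ioo_subset_Icc_self hz))).neg.hasDerivWithinAt)
      (hφ.mono_set (sub y x hy hx))
      (fun z hz => (neg_le_abs _).trans
        (hs_pt2 ha (hs_w_pos (sub y x hy hx (Ioo_subset_Icc_self hz))) rfl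
        (Real.rpow_pos_of_pos (hs_w_pos (sub y x hy hx (Ioo_subset_Icc_self hz))) α)))
    simp only [Pi.neg_apply] at this
    linarith [mono y x hy hx hxy]

lemma hs_sup2 (ha : 0 < α) (hd : DifferentiableOn ℝ h (Ioo (-1:ℝ) 1))
    (hf : IntegrableOn (fun y => ((deriv h y)^2 * (1 - y^2) + (h y)^2) * (1 - y^2)^α)
      (Ioo (-1:ℝ) 1)) {y : ℝ} (hy : y ∈ Ioo (-1:ℝ) 1) :
    (h y)^2 * (1 - y^2)^α ≤ (2 + (1+2*α) * ((1 + 2*α + 1/α)/α)) *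
      ∫ y in Ioo (-1:ℝ) 1, ((deriv h y)^2 * (1 - y^2) + (h y)^2) * (1 - y^2)^α := by
  obtain ⟨hq, hqb⟩ := hs_hardy ha hd hf
  set N := ∫ y in Ioo (-1:ℝ) 1, ((deriv h y)^2 * (1 - y^2) + (h y)^2) * (1 - y^2)^α with hN
  set Q := ∫ y in Ioo (-1:ℝ) 1, (h y)^2 * (1 - y^2)^α / (1 - y^2) with hQ
  set c := (h y)^2 * (1 - y^2)^α - (N + (1+2*α)*Q) with hc
  have hN0 : 0 ≤ N := setIntegral_nonneg measurableSet_Ioo fun y hy => by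
    have := hs_w_pos hy
    positivity
  have hcb : ∫ x in Ioo (-1:ℝ) 1, c ≤ N := by
    refine setIntegral_mono_on (integrableOn_const (by simp)) hf measurableSet_Ioo
      fun x hx => ?_
    have h1 := hs_sup ha hd hf hq hx hy
    have hw := hs_w_pos hx
    have : 0 ≤ (deriv h x)^2 * (1 - x^2) * (1 - x^2)^α := by positivity
    rw [add_mul]
    linarith
  have : ∫ x in Ioo (-1:ℝ) 1, c = 2 * c := by
    simp; norm_num
  have h3 := mul_le_mul_of_nonneg_left hqb (show 0 ≤ 1+2*α by positivity)
  nlinarith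
end

theorem hardy_sobolev_identity (p : ℝ) (hp : 1 < p) :
    ∃ C > (0:ℝ), ∀ h : ℝ → ℝ,
      DifferentiableOn ℝ h (Ioo (-1:ℝ) 1) →
      IntegrableOn
        (fun y => ((deriv h y)^2 * (1 - y^2) + (h y)^2) * (1 - y^2) ^ (2/(p-1)))
        (Ioo (-1:ℝ) 1) →
      (IntegrableOn (fun y => (h y)^2 * (1 - y^2) ^ (2/(p-1)) / (1 - y^2))
          (Ioo (-1:ℝ) 1) ∧
        Real.sqrt (∫ y in Ioo (-1:ℝ) 1, (h y)^2 * (1 - y^2) ^ (2/(p-1)) / (1 - y^2)) ≤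
          C * Real.sqrt (∫ y in Ioo (-1:ℝ) 1,
            ((deriv h y)^2 * (1 - y^2) + (h y)^2) * (1 - y^2) ^ (2/(p-1)))) ∧
      (IntegrableOn (fun y => |h y| ^ (p+1) * (1 - y^2) ^ (2/(p-1)))
          (Ioo (-1:ℝ) 1) ∧
        (∫ y in Ioo (-1:ℝ) 1, |h y| ^ (p+1) * (1 - y^2) ^ (2/(p-1))) ^ (1/(p+1)) ≤
          C * Real.sqrt (∫ y in Ioo (-1:ℝ) 1,
            ((deriv h y)^2 * (1 - y^2) + (h y)^2) * (1 - y^2) ^ (2/(p-1)))) ∧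
      (∀ y ∈ Ioo (-1:ℝ) 1,
        |h y| * (1 - y^2) ^ (1/(p-1)) ≤
          C * Real.sqrt (∫ y in Ioo (-1:ℝ) 1,
            ((deriv h y)^2 * (1 - y^2) + (h y)^2) * (1 - y^2) ^ (2/(p-1)))) := by
  have hp1 : 0 < p - 1 := by linarith
  have ha : 0 < 2/(p-1) := by positivity
  set α := 2/(p-1) with hα
  set A := (1 + 2*α + 1/α)/α with hA
  have hApos : 0 < A := by positivity
  set K := 2 + (1+2*α) * A with hK
  have hKpos : 0 < K := by positivity
  have hAK : A ≤ K := by nlinarith [mul_pos ha hApos]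
  refine ⟨Real.sqrt K, Real.sqrt_pos.mpr hKpos, fun h hd hf => ?_⟩
  obtain ⟨hq, hqb⟩ := hs_hardy ha hd hf
  have hsup := fun y hy => hs_sup2 ha hd hf (y := y) hy
  have hN0 : 0 ≤ ∫ y in Ioo (-1:ℝ) 1,
      ((deriv h y)^2 * (1 - y^2) + (h y)^2) * (1 - y^2) ^ α :=
    setIntegral_nonneg measurableSet_Ioo fun y hy => by
      have := hs_w_pos hy
      positivity
  set N := ∫ y in Ioo (-1:ℝ) 1,
      ((deriv h y)^2 * (1 - y^2) + (h y)^2) * (1 - y^2) ^ α with hN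
  rw [← Real.sqrt_mul hKpos.le]
  have hqK : ∫ y in Ioo (-1:ℝ) 1, (h y)^2 * (1 - y^2)^α / (1 - y^2) ≤ K * N :=
    hqb.trans (mul_le_mul_of_nonneg_right hAK hN0)
  have hKN : 0 ≤ K * N := by positivity
  have hsup' : ∀ y ∈ Ioo (-1:ℝ) 1, |h y| * (1 - y^2) ^ (1/(p-1)) ≤ Real.sqrt (K * N) := by
    intro y hy
    have hw := hs_w_pos hy
    apply Real.le_sqrt_of_sq_le
    rw [mul_pow, sq_abs, ← Real.rpow_natCast ((1 - y^2) ^ (1/(p-1))) 2, ← Real.rpow_mul hw.le]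
    have : 1/(p-1) * ((2:ℕ):ℝ) = α := by rw [hα]; push_cast; ring
    rw [this]
    exact hsup y hy
  set S := Real.sqrt (K * N) with hS
  have hS0 : 0 ≤ S := Real.sqrt_nonneg _
  have hpt : ∀ y ∈ Ioo (-1:ℝ) 1, |h y| ^ (p+1) * (1 - y^2) ^ α ≤
      S^(p-1) * ((h y)^2 * (1 - y^2)^α / (1 - y^2)) := by
    intro y hy
    have hw := hs_w_pos hy
    have h1 := Real.rpow_le_rpow (by positivity) (hsup' y hy) hp1.le
    rw [Real.mul_rpow (abs_nonneg _) (by positivity), ← Real.rpow_mul hw.le,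
      one_div_mul_cancel hp1.ne', Real.rpow_one] at h1
    have h2 : |h y| ^ (p+1) = |h y|^(p-1) * (h y)^2 := by
      rw [show p + 1 = (p-1) + 2 by ring, Real.rpow_add_of_nonneg (abs_nonneg _) hp1.le (by norm_num),
        Real.rpow_two, sq_abs]
    have h3 : 0 ≤ (h y)^2 * (1 - y^2)^α / (1 - y^2) := by positivity
    calc _ = |h y|^(p-1) * (1-y^2) * ((h y)^2 * (1 - y^2)^α / (1 - y^2)) := by
          rw [h2]; field_simp
      _ ≤ _ := mul_le_mul_of_nonneg_right h1 h3
  have hpt0 : ∀ y ∈ Ioo (-1:ℝ) 1, 0 ≤ |h y| ^ (p+1) * (1 - y^2) ^ α := fun y hy => by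
    have := hs_w_pos hy
    positivity
  have hint : IntegrableOn (fun y => |h y| ^ (p+1) * (1 - y^2) ^ α) (Ioo (-1:ℝ) 1) := by
    refine Integrable.mono' (hq.const_mul (S^(p-1))) ?_ ?_
    · refine ContinuousOn.aestronglyMeasurable (ContinuousOn.mul ?_ ?_) measurableSet_Ioo
      · exact hd.continuousOn.abs.rpow_const fun y hy => Or.inr (by linarith)
      · exact fun y hy => (hs_W_deriv α hy).continuousAt.continuousWithinAt
    · refine (ae_restrict_mem measurableSet_Ioo).mono fun y hy => ?_
      rw [Real.norm_of_nonneg (hpt0 y hy)]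
      exact hpt y hy
  refine ⟨⟨hq, Real.sqrt_le_sqrt hqK⟩, ⟨hint, ?_⟩, hsup'⟩
  have hb : ∫ y in Ioo (-1:ℝ) 1, |h y| ^ (p+1) * (1 - y^2) ^ α ≤ S^(p+1) := by
    calc _ ≤ ∫ y in Ioo (-1:ℝ) 1, S^(p-1) * ((h y)^2 * (1 - y^2)^α / (1 - y^2)) :=
          setIntegral_mono_on hint (hq.const_mul _) measurableSet_Ioo hpt
      _ = S^(p-1) * ∫ y in Ioo (-1:ℝ) 1, (h y)^2 * (1 - y^2)^α / (1 - y^2) :=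
          integral_const_mul _ _
      _ ≤ S^(p-1) * (K * N) := by gcongr
      _ = S^(p+1) := by
          rw [show p + 1 = (p-1) + 2 by ring, Real.rpow_add_of_nonneg hS0 hp1.le (by norm_num),
            Real.rpow_two, hS, Real.sq_sqrt hKN]
  calc _ ≤ (S^(p+1))^(1/(p+1)) :=
        Real.rpow_le_rpow (setIntegral_nonneg measurableSet_Ioo hpt0) hb (by positivity)
    _ = S := by
        rw [← Real.rpow_mul hS0, mul_one_div_cancel (by linarith), Real.rpow_one]
end

section
/- Fix p > 1. There exists a constant C ≥ 1, depending only on p, such that for every locally absolutely continuous h : (−1,1) → ℝ with ‖h‖²_{H₀} = ∫_{−1}^{1} (h'(y)² (1−y²) + h(y)²) ρ(y) dy < ∞, if h̄ : ℝ → ℝ is defined by h̄(ξ) = h(tanh ξ) · (1 − tanh² ξ)^{1/(p−1)}, then h̄ is locally absolutely continuous and (1/C) ‖h‖²_{H₀} ≤ ∫_ℝ (h̄'(ξ)² + h̄(ξ)²) dξ ≤ C ‖h‖²_{H₀}. -/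
open Real MeasureTheory Set

/-- The transformation `h ↦ h̄`, `h̄(ξ) = h(tanh ξ)(1 - tanh²ξ)^{1/(p-1)}`. -/
noncomputable def xiTransform (p : ℝ) (h : ℝ → ℝ) : ℝ → ℝ :=
  fun ξ => h (Real.tanh ξ) * (1 - Real.tanh ξ ^ 2) ^ ((1:ℝ)/(p-1))

lemma xi_hasDerivAt_tanh (x : ℝ) : HasDerivAt Real.tanh (1 - Real.tanh x ^ 2) x := by
  have h := (Real.hasDerivAt_sinh x).div (Real.hasDerivAt_cosh x) (Real.cosh_pos x).ne'
  have e : Real.tanh = Real.sinh / Real.cosh := by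
    funext y; simp [Real.tanh_eq_sinh_div_cosh]
  rw [e]
  refine h.congr_deriv ?_
  have := (Real.cosh_pos x).ne'
  rw [Pi.div_apply]
  field_simp

lemma xi_w_pos (x : ℝ) : 0 < 1 - Real.tanh x ^ 2 := by
  have h := Real.tanh_bijOn.mapsTo (mem_univ x)
  nlinarith [h.1, h.2]

lemma xi_tanh_nonneg {x : ℝ} (hx : 0 ≤ x) : 0 ≤ Real.tanh x := by
  rw [Real.tanh_eq_sinh_div_cosh]
  exact div_nonneg (Real.sinh_nonneg_iff.2 hx) (Real.cosh_pos x).le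

lemma xi_core (a : ℝ) (ha : 0 < a) (g : ℝ → ℝ) (hg : Differentiable ℝ g)
    (hN : Integrable (fun x => (deriv g x + 2 * a * Real.tanh x * g x) ^ 2
      + (1 - Real.tanh x ^ 2) * g x ^ 2)) :
    Integrable (fun x => deriv g x ^ 2 + g x ^ 2) ∧
    (∫ x, ((deriv g x + 2 * a * Real.tanh x * g x) ^ 2 + (1 - Real.tanh x ^ 2) * g x ^ 2))
      ≤ (3 + 8 * a ^ 2) * ∫ x, (deriv g x ^ 2 + g x ^ 2) ∧
    (∫ x, (deriv g x ^ 2 + g x ^ 2)) ≤ ((1 + 1 / (4 * a ^ 2)) * (1 + 2 * a) + 1) *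
      ∫ x, ((deriv g x + 2 * a * Real.tanh x * g x) ^ 2
        + (1 - Real.tanh x ^ 2) * g x ^ 2) := by
  set N : ℝ → ℝ := fun x => (deriv g x + 2 * a * Real.tanh x * g x) ^ 2
      + (1 - Real.tanh x ^ 2) * g x ^ 2 with hNdef
  set G : ℝ → ℝ := fun x => deriv g x ^ 2 + g x ^ 2 with hGdef
  set c := 1 + 1 / (4 * a ^ 2) with hc
  have hc0 : 0 < c := by positivity
  set K := c * (1 + 2 * a) + 1 with hK
  have hK0 : 0 < K := by positivity
  set D : ℝ → ℝ := fun x => (1 - Real.tanh x ^ 2) * g x ^ 2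
    + Real.tanh x * (2 * g x * deriv g x) with hD
  have hw := xi_w_pos
  have hN0 : ∀ x, 0 ≤ N x := fun x => by
    have := hw x; simp only [hNdef]; positivity
  have hG0 : ∀ x, 0 ≤ G x := fun x => by simp only [hGdef]; positivity
  have hDd : ∀ x, HasDerivAt (fun x => Real.tanh x * g x ^ 2) (D x) x := by
    intro x
    refine ((xi_hasDerivAt_tanh x).mul ((hg x).hasDerivAt.pow 2)).congr_deriv ?_
    simp [hD]
  have htc : Continuous Real.tanh :=
    continuous_iff_continuousAt.2 fun x => (xi_hasDerivAt_tanh x).continuousAt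
  have hgm : Measurable g := hg.continuous.measurable
  have htm : Measurable Real.tanh := htc.measurable
  have hdm : Measurable (deriv g) := measurable_deriv g
  have hGm : Measurable G := by fun_prop
  have hDm : Measurable D := by fun_prop
  have hGN : ∀ x, G x ≤ K * N x - 2 * a * c * D x := by
    intro x
    have h1 : deriv g x ^ 2 + 4 * a ^ 2 * Real.tanh x ^ 2 * g x ^ 2 ≤
        (1 + 2 * a) * N x - 2 * a * D x := by
      simp only [hNdef, hD]
      nlinarith [mul_nonneg ha.le (sq_nonneg (deriv g x + 2 * a * Real.tanh x * g x)),
        mul_nonneg (hw x).le (sq_nonneg (g x))]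
    have h2 := mul_le_mul_of_nonneg_left h1 hc0.le
    have h3 : deriv g x ^ 2 + Real.tanh x ^ 2 * g x ^ 2 ≤
        c * (deriv g x ^ 2 + 4 * a ^ 2 * Real.tanh x ^ 2 * g x ^ 2) := by
      have : c * (deriv g x ^ 2 + 4 * a ^ 2 * Real.tanh x ^ 2 * g x ^ 2) =
        deriv g x ^ 2 + Real.tanh x ^ 2 * g x ^ 2 + (deriv g x ^ 2 / (4 * a ^ 2)
          + 4 * a ^ 2 * Real.tanh x ^ 2 * g x ^ 2) := by
        rw [hc]; field_simp; ring
      rw [this]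
      have : 0 ≤ deriv g x ^ 2 / (4 * a ^ 2)
          + 4 * a ^ 2 * Real.tanh x ^ 2 * g x ^ 2 := by positivity
      linarith
    have h4 : (1 - Real.tanh x ^ 2) * g x ^ 2 ≤ N x := by
      simp only [hNdef]
      linarith [sq_nonneg (deriv g x + 2 * a * Real.tanh x * g x)]
    have h5 : G x = deriv g x ^ 2 + Real.tanh x ^ 2 * g x ^ 2
      + (1 - Real.tanh x ^ 2) * g x ^ 2 := by simp only [hGdef]; ring
    rw [h5, hK]
    linarith
  have ht1 : ∀ x, Real.tanh x ^ 2 * g x ^ 2 ≤ g x ^ 2 := fun x => by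
    nlinarith [hw x, mul_nonneg (hw x).le (sq_nonneg (g x))]
  have hGloc : ∀ r s : ℝ, IntervalIntegrable G volume r s := by
    intro r s
    have h1 : IntervalIntegrable (fun x => 2 * N x + (8 * a ^ 2 + 1) * g x ^ 2) volume r s :=
      (hN.intervalIntegrable.const_mul 2).add
        ((continuous_const.mul (hg.continuous.pow 2)).intervalIntegrable r s)
    refine h1.mono_fun hGm.aestronglyMeasurable (Filter.Eventually.of_forall fun x => ?_)
    beta_reduce
    rw [Real.norm_of_nonneg (hG0 x)]
    refine le_trans ?_ (le_abs_self _)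
    simp only [hGdef, hNdef]
    nlinarith [sq_nonneg (deriv g x + 4 * a * Real.tanh x * g x),
      mul_nonneg (hw x).le (sq_nonneg (g x)),
      mul_le_mul_of_nonneg_left (ht1 x) (sq_nonneg a)]
  have hDloc : ∀ r s : ℝ, IntervalIntegrable D volume r s := by
    intro r s
    refine ((hGloc r s).const_mul 2).mono_fun hDm.aestronglyMeasurable
      (Filter.Eventually.of_forall fun x => ?_)
    beta_reduce
    rw [Real.norm_of_nonneg (mul_nonneg zero_le_two (hG0 x)), Real.norm_eq_abs, abs_le]
    have h1 := ht1 x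
    have h2 := mul_nonneg (hw x).le (sq_nonneg (g x))
    simp only [hGdef, hD]
    constructor
    · nlinarith [sq_nonneg (deriv g x + Real.tanh x * g x), sq_nonneg (deriv g x),
        sq_nonneg (g x)]
    · nlinarith [sq_nonneg (deriv g x - Real.tanh x * g x), sq_nonneg (deriv g x),
        sq_nonneg (g x), sq_nonneg (Real.tanh x * g x)]
  have hbd : ∀ n : ℕ, ∫ x in (-(n:ℝ))..n, G x ≤ K * ∫ x, N x := by
    intro n
    have hn : (0:ℝ) ≤ n := n.cast_nonneg
    have hle : -(n:ℝ) ≤ n := by linarith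
    have hDi : 0 ≤ ∫ x in (-(n:ℝ))..n, D x := by
      rw [intervalIntegral.integral_eq_sub_of_hasDerivAt (fun x _ => hDd x) (hDloc _ _)]
      have := xi_tanh_nonneg hn
      rw [Real.tanh_neg]
      have h1 := mul_nonneg this (sq_nonneg (g n))
      have h2 := mul_nonneg this (sq_nonneg (g (-n)))
      linarith
    calc ∫ x in (-(n:ℝ))..n, G x ≤ ∫ x in (-(n:ℝ))..n, (K * N x - 2 * a * c * D x) :=
          intervalIntegral.integral_mono_on hle (hGloc _ _)
            ((hN.intervalIntegrable.const_mul K).sub ((hDloc _ _).const_mul _))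
            (fun x _ => hGN x)
      _ = K * (∫ x in (-(n:ℝ))..n, N x) - 2 * a * c * ∫ x in (-(n:ℝ))..n, D x := by
          rw [intervalIntegral.integral_sub (hN.intervalIntegrable.const_mul K)
            ((hDloc _ _).const_mul _), intervalIntegral.integral_const_mul,
            intervalIntegral.integral_const_mul]
      _ ≤ K * (∫ x in (-(n:ℝ))..n, N x) := by
          have : 0 ≤ 2 * a * c * ∫ x in (-(n:ℝ))..n, D x := by positivity
          linarith
      _ ≤ K * ∫ x, N x := by
          refine mul_le_mul_of_nonneg_left ?_ hK0.le
          rw [intervalIntegral.integral_of_le hle]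
          exact setIntegral_le_integral hN (Filter.Eventually.of_forall hN0)
  have hT : Filter.Tendsto (fun n : ℕ => (n:ℝ)) Filter.atTop Filter.atTop :=
    tendsto_natCast_atTop_atTop
  have hT' : Filter.Tendsto (fun n : ℕ => -(n:ℝ)) Filter.atTop Filter.atBot :=
    Filter.tendsto_neg_atTop_atBot.comp hT
  have hGi : Integrable G := by
    refine integrable_of_intervalIntegral_norm_bounded (K * ∫ x, N x)
      (fun n => (hGloc _ _).1) hT' hT (Filter.Eventually.of_forall fun n => ?_)
    have : (fun x => ‖G x‖) = G := funext fun x => Real.norm_of_nonneg (hG0 x)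
    simp only [this]
    exact hbd n
  refine ⟨hGi, ?_, ?_⟩
  · rw [← integral_const_mul]
    refine integral_mono hN (hGi.const_mul _) fun x => ?_
    simp only [hGdef, hNdef]
    nlinarith [sq_nonneg (deriv g x - 2 * a * Real.tanh x * g x),
      mul_le_mul_of_nonneg_left (ht1 x) (sq_nonneg a), sq_nonneg (a * deriv g x),
      sq_nonneg (Real.tanh x * g x), sq_nonneg (deriv g x), sq_nonneg (g x)]
  · exact le_of_tendsto (intervalIntegral_tendsto_integral hGi hT' hT)
      (Filter.Eventually.of_forall hbd)

lemma xi_hasDerivAt (a : ℝ) (h : ℝ → ℝ) (hd : DifferentiableOn ℝ h (Ioo (-1:ℝ) 1)) (x : ℝ) :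
    HasDerivAt (fun ξ => h (Real.tanh ξ) * (1 - Real.tanh ξ ^ 2) ^ a)
      (deriv h (Real.tanh x) * (1 - Real.tanh x ^ 2) * (1 - Real.tanh x ^ 2) ^ a
        - 2 * a * Real.tanh x * (h (Real.tanh x) * (1 - Real.tanh x ^ 2) ^ a)) x := by
  have hm := Real.tanh_bijOn.mapsTo (mem_univ x)
  have h1 : HasDerivAt h (deriv h (Real.tanh x)) (Real.tanh x) :=
    (hd.differentiableAt (isOpen_Ioo.mem_nhds hm)).hasDerivAt
  have hw := xi_w_pos x
  have h2 := h1.comp x (xi_hasDerivAt_tanh x)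
  have h3 := (((xi_hasDerivAt_tanh x).pow 2).const_sub 1).rpow_const (p := a) (Or.inl hw.ne')
  refine (h2.mul h3).congr_deriv ?_
  have : (1 - Real.tanh x ^ 2) ^ (a - 1) * (1 - Real.tanh x ^ 2) = (1 - Real.tanh x ^ 2) ^ a := by
    rw [Real.rpow_sub_one hw.ne']; field_simp
  simp only [Function.comp, Pi.pow_apply]
  rw [← this]
  push_cast
  ring

/-- The change of variables `y = tanh ξ`, `h̄(ξ) = h(y)(1-y²)^{1/(p-1)}` transforms the
weighted `H₀` norm `∫_{-1}^{1} (h'²(1-y²) + h²) ρ dy`, `ρ(y) = (1-y²)^{2/(p-1)}`, into a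
norm equivalent to the `H¹(ℝ)` norm of `h̄`. -/
theorem xiTransform_norm_equivalence (p : ℝ) (hp : 1 < p) :
    ∃ C ≥ (1:ℝ), ∀ h : ℝ → ℝ,
      DifferentiableOn ℝ h (Ioo (-1:ℝ) 1) →
      IntegrableOn
        (fun y => ((deriv h y)^2 * (1 - y^2) + (h y)^2) * (1 - y^2) ^ (2/(p-1)))
        (Ioo (-1:ℝ) 1) →
      Differentiable ℝ (xiTransform p h) ∧
      Integrable (fun ξ : ℝ => (deriv (xiTransform p h) ξ)^2 + (xiTransform p h ξ)^2) ∧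
      (1/C) * (∫ y in Ioo (-1:ℝ) 1,
          ((deriv h y)^2 * (1 - y^2) + (h y)^2) * (1 - y^2) ^ (2/(p-1))) ≤
        (∫ ξ : ℝ, ((deriv (xiTransform p h) ξ)^2 + (xiTransform p h ξ)^2)) ∧
      (∫ ξ : ℝ, ((deriv (xiTransform p h) ξ)^2 + (xiTransform p h ξ)^2)) ≤
        C * ∫ y in Ioo (-1:ℝ) 1,
          ((deriv h y)^2 * (1 - y^2) + (h y)^2) * (1 - y^2) ^ (2/(p-1)) := by
  set a := 1 / (p - 1) with ha_def
  have ha : 0 < a := by have : 0 < p - 1 := by linarith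
                        positivity
  have h2a : 2 / (p - 1) = a + a := by rw [ha_def]; ring
  set K := (1 + 1 / (4 * a ^ 2)) * (1 + 2 * a) + 1 with hK
  have hK0 : 0 < K := by positivity
  refine ⟨K + (3 + 8 * a ^ 2), by nlinarith [sq_nonneg a], fun h hd hi => ?_⟩
  have hder := xi_hasDerivAt a h hd
  have hgd : Differentiable ℝ (xiTransform p h) := fun x => (hder x).differentiableAt
  have hw := xi_w_pos
  have himg : Real.tanh '' univ = Ioo (-1:ℝ) 1 := Real.tanh_bijOn.image_eq
  have hdw : ∀ x ∈ (univ : Set ℝ), HasDerivWithinAt Real.tanh (1 - Real.tanh x ^ 2) univ x :=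
    fun x _ => (xi_hasDerivAt_tanh x).hasDerivWithinAt
  have hinj : InjOn Real.tanh univ := Real.tanh_injective.injOn
  set F : ℝ → ℝ := fun y =>
    ((deriv h y)^2 * (1 - y^2) + (h y)^2) * (1 - y^2) ^ (2/(p-1)) with hF
  have hFN : (fun x => |1 - Real.tanh x ^ 2| • F (Real.tanh x)) =
      fun x => (deriv (xiTransform p h) x + 2 * a * Real.tanh x * xiTransform p h x) ^ 2
        + (1 - Real.tanh x ^ 2) * xiTransform p h x ^ 2 := by
    funext x
    have e1 : deriv (xiTransform p h) x = _ := (hder x).deriv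
    have e2 : xiTransform p h x = h (Real.tanh x) * (1 - Real.tanh x ^ 2) ^ a := rfl
    rw [e1, e2, abs_of_pos (hw x), smul_eq_mul]
    simp only [hF]
    rw [h2a, Real.rpow_add (hw x)]
    ring
  have hcv := integral_image_eq_integral_abs_deriv_smul MeasurableSet.univ hdw hinj F
  have hci := integrableOn_image_iff_integrableOn_abs_deriv_smul MeasurableSet.univ hdw hinj F
  rw [himg, hFN] at hcv hci
  rw [setIntegral_univ] at hcv
  rw [integrableOn_univ] at hci
  obtain ⟨c1, c2, c3⟩ := xi_core a ha _ hgd (hci.1 hi)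
  rw [← hcv] at c2 c3
  have hI0 : 0 ≤ ∫ ξ : ℝ, ((deriv (xiTransform p h) ξ)^2 + (xiTransform p h ξ)^2) :=
    integral_nonneg fun x => by positivity
  have hF0 : 0 ≤ ∫ y in Ioo (-1:ℝ) 1, F y := by
    by_contra hneg
    push Not at hneg
    have := mul_neg_of_pos_of_neg hK0 hneg
    linarith
  refine ⟨hgd, c1, ?_, ?_⟩
  · rw [one_div, inv_mul_le_iff₀ (by positivity)]
    have := mul_nonneg hK0.le hI0
    linarith
  · have : 0 ≤ (3 + 8 * a ^ 2) * ∫ y in Ioo (-1:ℝ) 1, F y := by positivity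
    linarith
end

section
/- Fix p > 1 and let k ≥ 1 be an integer. There exists a constant C > 0, depending only on p and k, such that for all d₁, …, d_k ∈ (−1,1), all signs e₁, …, e_k ∈ {−1,1}, and all pairs r = (r₁, r₂), r̂ = (r̂₁, r̂₂) of functions on (−1,1) with r₁, r̂₁ locally absolutely continuous and ‖r‖_H < ∞, ‖r̂‖_H < ∞, one has |∫_{−1}^{1} ( r₁'(y) r̂₁'(y) (1−y²) − ψ(y) r₁(y) r̂₁(y) + r₂(y) r̂₂(y) ) ρ(y) dy| ≤ C ‖r‖_H ‖r̂‖_H, where ψ(y) = p |Σ_{i=1}^{k} e_i κ(d_i, y)|^{p−1} − 2(p+1)/(p−1)². -/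
open Real MeasureTheory Set

/-- The soliton `κ(d,y) = κ₀ (1-d²)^{1/(p-1)} (1+dy)^{-2/(p-1)}` with
`κ₀ = (2(p+1)/(p-1)²)^{1/(p-1)}`. -/
noncomputable def kappa (p d y : ℝ) : ℝ :=
  (2*(p+1)/(p-1)^2) ^ (1/(p-1)) * (1-d^2) ^ (1/(p-1)) * (1+d*y) ^ (-(2/(p-1)))

lemma aux_F_deriv (α : ℝ) (r : ℝ → ℝ) (hr : DifferentiableOn ℝ r (Ioo (-1:ℝ) 1))
    (y : ℝ) (hy : y ∈ Ioo (-1:ℝ) 1) :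
    HasDerivAt (fun y => y * (r y)^2 * (1-y^2)^α)
      ((r y)^2 * (1-y^2)^α + 2 * y * r y * deriv r y * (1-y^2)^α
        - 2 * α * y^2 * (r y)^2 * (1-y^2)^(α-1)) y := by
  have hw : 0 < 1 - y^2 := by nlinarith [hy.1, hy.2]
  have h1 : HasDerivAt r (deriv r y) y :=
    ((hr y hy).differentiableAt (isOpen_Ioo.mem_nhds hy)).hasDerivAt
  have h2 : HasDerivAt (fun y : ℝ => 1 - y^2) (-(2*y)) y := by
    have := (hasDerivAt_pow 2 y).const_sub 1
    exact this.congr_deriv (by norm_num)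
  have h3 := h2.rpow_const (p := α) (Or.inl hw.ne')
  have h4 := ((hasDerivAt_id' y).fun_mul (h1.fun_pow 2)).fun_mul h3
  refine h4.congr_deriv ?_
  norm_num
  ring

lemma aux_pt (α : ℝ) (hα : 0 < α) (y r s t V : ℝ) (hw : 0 < 1 - y^2) (hV : 0 < V) :
    r^2 * ((1-y^2)*V) + 2*y*r*s*((1-y^2)*V) - 2*α*y^2*r^2*V ≤
      (1 + 1/α + α) * ((r^2 + s^2*(1-y^2) + t^2) * ((1-y^2)*V)) - α * (r^2 * V) := by
  have key : 0 ≤ V / α * (α*y*r - s*(1-y^2))^2 := by positivity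
  have e : V / α * (α*y*r - s*(1-y^2))^2 =
      α*y^2*r^2*V - 2*y*r*s*((1-y^2)*V) + (1/α) * (s^2*(1-y^2)*((1-y^2)*V)) := by
    field_simp
    ring
  have a1 : 0 ≤ (1/α) * ((r^2+t^2) * ((1-y^2)*V)) := by positivity
  have a2 : 0 ≤ (1+α) * ((s^2*(1-y^2)+t^2) * ((1-y^2)*V)) := by positivity
  rw [e] at key
  nlinarith [key, a1, a2]

lemma aux_hardy (α : ℝ) (hα : 0 < α) (r r₂ : ℝ → ℝ)
    (hr : DifferentiableOn ℝ r (Ioo (-1:ℝ) 1))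
    (hN : IntegrableOn (fun y => ((r y)^2 + (deriv r y)^2 * (1-y^2) + (r₂ y)^2) * (1-y^2) ^ α)
      (Ioo (-1:ℝ) 1)) :
    IntegrableOn (fun y => (r y)^2 * (1-y^2)^(α-1)) (Ioo (-1:ℝ) 1) ∧
    ∫ y in Ioo (-1:ℝ) 1, (r y)^2 * (1-y^2)^(α-1) ≤ (1 + 1/α + α)/α *
      ∫ y in Ioo (-1:ℝ) 1, ((r y)^2 + (deriv r y)^2 * (1-y^2) + (r₂ y)^2) * (1-y^2) ^ α := by
  set N := (fun y => ((r y)^2 + (deriv r y)^2 * (1-y^2) + (r₂ y)^2) * (1-y^2) ^ α) with hNd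
  set A := (fun y => (r y)^2 * (1-y^2)^(α-1)) with hAd
  have hpos : ∀ y ∈ Ioo (-1:ℝ) 1, 0 < 1 - y^2 := fun y hy => by nlinarith [hy.1, hy.2]
  have hN0 : ∀ y ∈ Ioo (-1:ℝ) 1, 0 ≤ N y := fun y hy => by
    have := hpos y hy
    simp only [hNd]
    positivity
  have hA0 : ∀ y ∈ Ioo (-1:ℝ) 1, 0 ≤ A y := fun y hy => by
    have := hpos y hy
    simp only [hAd]
    positivity
  have hAc : ContinuousOn A (Ioo (-1:ℝ) 1) := by
    apply (hr.continuousOn.pow 2).mul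
    apply ContinuousOn.rpow_const (by fun_prop)
    intro y hy
    exact Or.inl (hpos y hy).ne'
  have hbound : ∀ a : ℝ, 0 < a → a < 1 →
      ∫ y in Icc (-a) a, A y ≤ (1 + 1/α + α)/α * ∫ y in Ioo (-1:ℝ) 1, N y := by
    intro a ha0 ha1
    have hsub : Icc (-a) a ⊆ Ioo (-1:ℝ) 1 := fun y hy => ⟨by linarith [hy.1], by linarith [hy.2]⟩
    have hNi : IntegrableOn N (Icc (-a) a) := hN.mono_set hsub
    have hAi : IntegrableOn A (Icc (-a) a) := (hAc.mono hsub).integrableOn_compact isCompact_Icc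
    have h := intervalIntegral.sub_le_integral_of_hasDeriv_right_of_le (a := -a) (b := a)
      (g := fun y => y * (r y)^2 * (1-y^2)^α)
      (g' := fun y => ((r y)^2 * (1-y^2)^α + 2 * y * r y * deriv r y * (1-y^2)^α
        - 2 * α * y^2 * (r y)^2 * (1-y^2)^(α-1)))
      (φ := fun y => (1 + 1/α + α) * N y - α * A y) (by linarith)
      (fun y hy => (aux_F_deriv α r hr y (hsub hy)).continuousAt.continuousWithinAt)
      (fun y hy => (aux_F_deriv α r hr y (hsub (Ioo_subset_Icc_self hy))).hasDerivWithinAt)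
      ((hNi.const_mul _).sub (hAi.const_mul _))
      (by
        intro y hy
        have hw := hpos y (hsub (Ioo_subset_Icc_self hy))
        have e : (1-y^2)^α = (1-y^2) * (1-y^2)^(α-1) := by
          rw [Real.rpow_sub_one hw.ne']
          field_simp
        simp only [hNd, hAd]
        rw [e]
        exact aux_pt α hα y (r y) (deriv r y) (r₂ y) _ hw (by positivity))
    have hb : 0 ≤ a * r a ^ 2 * (1 - a ^ 2) ^ α - -a * r (-a) ^ 2 * (1 - (-a) ^ 2) ^ α := by
      have : 0 < 1 - a^2 := by nlinarith
      have e : a * r a ^ 2 * (1 - a ^ 2) ^ α - -a * r (-a) ^ 2 * (1 - (-a) ^ 2) ^ α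
        = a * r a ^ 2 * (1 - a ^ 2) ^ α + a * r (-a) ^ 2 * (1 - a ^ 2) ^ α := by
        rw [neg_sq]; ring
      rw [e]; positivity
    have h5 := hb.trans h
    rw [intervalIntegral.integral_of_le (by linarith), ← integral_Icc_eq_integral_Ioc,
      integral_sub (hNi.const_mul _) (hAi.const_mul _), integral_const_mul,
      integral_const_mul] at h5
    have h6 : ∫ y in Icc (-a) a, N y ≤ ∫ y in Ioo (-1:ℝ) 1, N y := by
      apply setIntegral_mono_set hN
      · filter_upwards [ae_restrict_mem measurableSet_Ioo] with y hy using hN0 y hy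
      · exact hsub.eventuallyLE
    have h7 : (1 + 1/α + α) * ∫ y in Icc (-a) a, N y ≤
        (1 + 1/α + α) * ∫ y in Ioo (-1:ℝ) 1, N y :=
      mul_le_mul_of_nonneg_left h6 (by positivity)
    rw [div_mul_eq_mul_div, le_div_iff₀ hα]
    linarith
  have hseq : ∀ n : ℕ, 0 < 1 - 1/((n:ℝ)+2) ∧ 1 - 1/((n:ℝ)+2) < 1 := by
    intro n
    have : (0:ℝ) < (n:ℝ)+2 := by positivity
    constructor
    · rw [sub_pos, div_lt_one this]; have := n.cast_nonneg (α := ℝ); linarith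
    · have : 0 < 1/((n:ℝ)+2) := by positivity
      linarith
  have hlim : Filter.Tendsto (fun n : ℕ => 1 - 1/((n:ℝ)+2)) Filter.atTop (nhds 1) := by
    have h1 : Filter.Tendsto (fun n : ℕ => (n:ℝ)+2) Filter.atTop Filter.atTop :=
      Filter.tendsto_atTop_add_const_right _ _ tendsto_natCast_atTop_atTop
    have := (h1.inv_tendsto_atTop).const_sub 1
    simpa using this
  have hcov : AECover (volume.restrict (Ioo (-1:ℝ) 1)) Filter.atTop
      (fun n : ℕ => Icc (-(1 - 1/((n:ℝ)+2))) (1 - 1/((n:ℝ)+2))) :=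
    aecover_Ioo_of_Icc hlim.neg hlim
  have hsub : ∀ n : ℕ, Icc (-(1 - 1/((n:ℝ)+2))) (1 - 1/((n:ℝ)+2)) ⊆ Ioo (-1:ℝ) 1 :=
    fun n y hy => ⟨by linarith [hy.1, (hseq n).2], by linarith [hy.2, (hseq n).2]⟩
  have hres : ∀ n : ℕ, (volume.restrict (Ioo (-1:ℝ) 1)).restrict
      (Icc (-(1 - 1/((n:ℝ)+2))) (1 - 1/((n:ℝ)+2))) =
      volume.restrict (Icc (-(1 - 1/((n:ℝ)+2))) (1 - 1/((n:ℝ)+2))) := by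
    intro n
    rw [Measure.restrict_restrict measurableSet_Icc, inter_eq_left.mpr (hsub n)]
  have hb2 : ∀ n : ℕ, ∫ y in Icc (-(1 - 1/((n:ℝ)+2))) (1 - 1/((n:ℝ)+2)), A y
      ∂(volume.restrict (Ioo (-1:ℝ) 1)) ≤ (1 + 1/α + α)/α * ∫ y in Ioo (-1:ℝ) 1, N y := by
    intro n
    rw [hres n]
    exact hbound _ (hseq n).1 (hseq n).2
  have hAint : Integrable A (volume.restrict (Ioo (-1:ℝ) 1)) := by
    refine hcov.integrable_of_integral_bounded_of_nonneg_ae _ (fun n => ?_) ?_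
      (Filter.Eventually.of_forall hb2)
    · unfold IntegrableOn
      rw [hres n]
      exact (hAc.mono (hsub n)).integrableOn_compact isCompact_Icc
    · filter_upwards [ae_restrict_mem measurableSet_Ioo] with y hy using hA0 y hy
  exact ⟨hAint, le_of_tendsto' (hcov.integral_tendsto_of_countably_generated hAint) hb2⟩

lemma aux_kappa (p : ℝ) (hp : 1 < p) (d y : ℝ) (hd : d ∈ Ioo (-1:ℝ) 1)
    (hy : y ∈ Ioo (-1:ℝ) 1) :
    |kappa p d y| ≤ (2*(p+1)/(p-1)^2) ^ (1/(p-1)) * (1-y^2) ^ (-(1/(p-1))) := by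
  have hp1 : 0 < p - 1 := by linarith
  have hdd : 0 < 1 - d^2 := by nlinarith [hd.1, hd.2]
  have hw : 0 < 1 - y^2 := by nlinarith [hy.1, hy.2]
  have hdy : 0 < 1 + d*y := by nlinarith [hd.1, hd.2, hy.1, hy.2]
  have hc : 0 < 2*(p+1)/(p-1)^2 := by positivity
  have hb : 0 < 1/(p-1) := by positivity
  unfold kappa
  rw [abs_of_nonneg (by positivity), mul_assoc]
  apply mul_le_mul_of_nonneg_left _ (by positivity)
  have e1 : (1+d*y) ^ (-(2/(p-1))) = ((1+d*y)^2) ^ (-(1/(p-1))) := by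
    rw [← Real.rpow_natCast, ← Real.rpow_mul hdy.le]
    congr 1
    push_cast
    ring
  have h1 : ((1+d*y)^2) ^ (-(1/(p-1))) ≤ ((1-d^2)*(1-y^2)) ^ (-(1/(p-1))) := by
    apply Real.rpow_le_rpow_of_nonpos (by positivity) _ (by linarith)
    nlinarith [sq_nonneg (d+y)]
  rw [Real.mul_rpow hdd.le hw.le] at h1
  rw [e1]
  calc _ ≤ (1-d^2) ^ (1/(p-1)) * ((1-d^2) ^ (-(1/(p-1))) * (1-y^2) ^ (-(1/(p-1)))) :=
        mul_le_mul_of_nonneg_left h1 (by positivity)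
    _ = _ := by
      rw [← mul_assoc, ← Real.rpow_add hdd]
      simp

lemma aux_psi (p : ℝ) (hp : 1 < p) (k : ℕ) (d e : ℕ → ℝ)
    (hd : ∀ i, 1 ≤ i → i ≤ k → d i ∈ Ioo (-1:ℝ) 1)
    (he : ∀ i, 1 ≤ i → i ≤ k → e i = 1 ∨ e i = -1) (y : ℝ) (hy : y ∈ Ioo (-1:ℝ) 1) :
    |∑ i ∈ Finset.Icc 1 k, e i * kappa p (d i) y| ^ (p-1) * (1-y^2) ≤
      (k:ℝ)^(p-1) * (2*(p+1)/(p-1)^2) := by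
  have hp1 : 0 < p - 1 := by linarith
  have hw : 0 < 1 - y^2 := by nlinarith [hy.1, hy.2]
  have hc : 0 < 2*(p+1)/(p-1)^2 := by positivity
  have h1 : |∑ i ∈ Finset.Icc 1 k, e i * kappa p (d i) y| ≤
      k * ((2*(p+1)/(p-1)^2) ^ (1/(p-1)) * (1-y^2) ^ (-(1/(p-1)))) := by
    refine (Finset.abs_sum_le_sum_abs _ _).trans ?_
    refine (Finset.sum_le_card_nsmul _ _
      ((2*(p+1)/(p-1)^2) ^ (1/(p-1)) * (1-y^2) ^ (-(1/(p-1)))) ?_).trans ?_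
    · intro i hi
      rw [Finset.mem_Icc] at hi
      rw [abs_mul]
      have : |e i| = 1 := by rcases he i hi.1 hi.2 with h | h <;> simp [h]
      rw [this, one_mul]
      exact aux_kappa p hp _ _ (hd i hi.1 hi.2) hy
    · simp
  have h2 := Real.rpow_le_rpow (abs_nonneg _) h1 hp1.le
  rw [Real.mul_rpow (by positivity) (by positivity), Real.mul_rpow (by positivity) (by positivity),
    ← Real.rpow_mul hc.le, ← Real.rpow_mul hw.le] at h2
  have e1 : 1/(p-1)*(p-1) = 1 := by field_simp
  have e2 : -(1/(p-1))*(p-1) = -1 := by field_simp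
  rw [e1, e2, Real.rpow_one, Real.rpow_neg_one] at h2
  calc _ ≤ ((k:ℝ)^(p-1) * (2*(p+1)/(p-1)^2 * (1-y^2)⁻¹)) * (1-y^2) :=
        mul_le_mul_of_nonneg_right h2 hw.le
    _ = _ := by field_simp

lemma aux_cs (w V r r' s q q' t : ℝ) (hw : 0 < w) (hV : 0 < V) :
    |r'*q'| * (w*(w*V)) + |r*q| * V + |s*t| * (w*V) ≤
      √(r^2*V + (r^2 + r'^2*w + s^2)*(w*V)) * √(q^2*V + (q^2 + q'^2*w + t^2)*(w*V)) := by
  rw [← Real.sqrt_mul (by positivity)]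
  apply Real.le_sqrt_of_sq_le
  have hs : √w^2 = w := Real.sq_sqrt hw.le
  have h1 : (|r'*q'| * (w*(w*V)) + |r*q| * V + |s*t| * (w*V))^2 ≤
      (r^2*V + (r'^2*w + s^2)*(w*V)) * (q^2*V + (q'^2*w + t^2)*(w*V)) := by
    simp only [abs_mul]
    rw [← sq_abs r, ← sq_abs r', ← sq_abs q, ← sq_abs q', ← sq_abs s, ← sq_abs t]
    generalize |r| = r, |r'| = r', |q| = q, |q'| = q', |s| = s, |t| = t
    have i1 : 0 ≤ V^2*w^2*(r'*q - r*q')^2 := by positivity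
    have i2 : 0 ≤ V^2*w*(s*q - r*t)^2 := by positivity
    have i3 : 0 ≤ V^2*w^3*(r'*t - s*q')^2 := by positivity
    nlinarith [i1, i2, i3]
  refine h1.trans ?_
  have : 0 ≤ w*V := by positivity
  gcongr <;> nlinarith [sq_nonneg r, sq_nonneg q]

lemma aux_pt2 (p M c w V S r r' s q q' t : ℝ) (hp : 0 < p) (hM : 0 ≤ M) (hc : 0 ≤ c)
    (hw : 0 < w) (hw1 : w ≤ 1) (hV : 0 < V) (hS : 0 ≤ S) (hSM : S * w ≤ M) :
    |(r'*q'*w - (p*S - c)*r*q + s*t)*(w*V)| ≤ (1 + p*M + c) *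
      (|r'*q'| * (w*(w*V)) + |r*q| * V + |s*t| * (w*V)) := by
  have e : (r'*q'*w - (p*S - c)*r*q + s*t)*(w*V) =
    (r'*q') * (w*(w*V)) - ((p*(S*w) - c*w)) * ((r*q)*V) + (s*t)*(w*V) := by ring
  have h1 : |(r'*q') * (w*(w*V))| = |r'*q'| * (w*(w*V)) := by
    rw [abs_mul, abs_of_pos (a := w*(w*V)) (by positivity)]
  have h2 : |(s*t)*(w*V)| = |s*t| * (w*V) := by
    rw [abs_mul, abs_of_pos (a := w*V) (by positivity)]
  have h3 : |((p*(S*w) - c*w)) * ((r*q)*V)| ≤ (p*M+c) * (|r*q| * V) := by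
    rw [abs_mul, abs_mul (r*q) V, abs_of_pos hV]
    apply mul_le_mul_of_nonneg_right _ (by positivity)
    have b1 : p*(S*w) ≤ p*M := mul_le_mul_of_nonneg_left hSM hp.le
    have b2 : 0 ≤ p*(S*w) := by positivity
    have b3 : c*w ≤ c := mul_le_of_le_one_right hc hw1
    have b4 : 0 ≤ c*w := by positivity
    have b5 : 0 ≤ p*M := by positivity
    rw [abs_le]
    constructor <;> linarith
  rw [e]
  have h4 := abs_add_le ((r'*q') * (w*(w*V)) - ((p*(S*w) - c*w)) * ((r*q)*V)) ((s*t)*(w*V))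
  have h5 := abs_sub ((r'*q') * (w*(w*V))) (((p*(S*w) - c*w)) * ((r*q)*V))
  have x1 : 0 ≤ (p*M+c) * (|r'*q'| * (w*(w*V))) := by positivity
  have x2 : 0 ≤ |r*q| * V := by positivity
  have x3 : 0 ≤ (p*M+c) * (|s*t| * (w*V)) := by positivity
  rw [h1] at h5
  rw [h2] at h4
  linarith

lemma aux_L2 (μ : Measure ℝ) (F G : ℝ → ℝ) (hF : Integrable F μ) (hG : Integrable G μ)
    (hF0 : ∀ᵐ y ∂μ, 0 ≤ F y) (hG0 : ∀ᵐ y ∂μ, 0 ≤ G y) :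
    Integrable (fun y => √(F y) * √(G y)) μ ∧
    ∫ y, √(F y) * √(G y) ∂μ ≤ √(∫ y, F y ∂μ) * √(∫ y, G y ∂μ) := by
  have key : ∀ F : ℝ → ℝ, Integrable F μ → (∀ᵐ y ∂μ, 0 ≤ F y) →
      MemLp (fun y => √(F y)) 2 μ ∧ ∫ y, √(F y) ^ (2:ℝ) ∂μ = ∫ y, F y ∂μ := by
    intro F hF hF0
    have hm : AEStronglyMeasurable (fun y => √(F y)) μ :=
      Real.continuous_sqrt.comp_aestronglyMeasurable hF.aestronglyMeasurable
    constructor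
    · rw [memLp_two_iff_integrable_sq hm]
      apply hF.congr
      filter_upwards [hF0] with y hy
      rw [Real.sq_sqrt hy]
    · apply integral_congr_ae
      filter_upwards [hF0] with y hy
      rw [Real.rpow_two, Real.sq_sqrt hy]
  obtain ⟨f1, f2⟩ := key F hF hF0
  obtain ⟨g1, g2⟩ := key G hG hG0
  refine ⟨f1.integrable_mul g1, ?_⟩
  have h := integral_mul_le_Lp_mul_Lq_of_nonneg (μ := μ) Real.HolderConjugate.two_two
    (f := fun y => √(F y)) (g := fun y => √(G y))
    (Filter.Eventually.of_forall fun _ => Real.sqrt_nonneg _)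
    (Filter.Eventually.of_forall fun _ => Real.sqrt_nonneg _) (by simpa using f1) (by simpa using g1)
  rw [f2, g2, ← Real.sqrt_eq_rpow, ← Real.sqrt_eq_rpow] at h
  exact h

/-- Uniform continuity on `H × H` of the bilinear form
`φ(r,r̂) = ∫ (r₁'r̂₁'(1-y²) - ψ r₁r̂₁ + r₂r̂₂) ρ dy`, where
`ψ = p|Σ e_i κ(d_i,·)|^{p-1} - 2(p+1)/(p-1)²` and `ρ(y) = (1-y²)^{2/(p-1)}`:
the constant depends only on `p` and `k`, not on the `d_i` nor on the signs `e_i`. -/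
theorem bilinear_form_continuity (p : ℝ) (hp : 1 < p) (k : ℕ) (hk : 1 ≤ k) :
    ∃ C > (0:ℝ), ∀ d e : ℕ → ℝ,
      (∀ i, 1 ≤ i → i ≤ k → d i ∈ Ioo (-1:ℝ) 1) →
      (∀ i, 1 ≤ i → i ≤ k → e i = 1 ∨ e i = -1) →
      ∀ r₁ r₂ q₁ q₂ : ℝ → ℝ,
        DifferentiableOn ℝ r₁ (Ioo (-1:ℝ) 1) →
        DifferentiableOn ℝ q₁ (Ioo (-1:ℝ) 1) →
        Measurable r₂ → Measurable q₂ →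
        IntegrableOn
          (fun y => ((r₁ y)^2 + (deriv r₁ y)^2 * (1-y^2) + (r₂ y)^2) *
            (1-y^2) ^ (2/(p-1))) (Ioo (-1:ℝ) 1) →
        IntegrableOn
          (fun y => ((q₁ y)^2 + (deriv q₁ y)^2 * (1-y^2) + (q₂ y)^2) *
            (1-y^2) ^ (2/(p-1))) (Ioo (-1:ℝ) 1) →
        IntegrableOn
          (fun y => (deriv r₁ y * deriv q₁ y * (1-y^2)
            - (p * |∑ i ∈ Finset.Icc 1 k, e i * kappa p (d i) y| ^ (p-1)
                - 2*(p+1)/(p-1)^2) * r₁ y * q₁ y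
            + r₂ y * q₂ y) * (1-y^2) ^ (2/(p-1))) (Ioo (-1:ℝ) 1) ∧
        |∫ y in Ioo (-1:ℝ) 1, (deriv r₁ y * deriv q₁ y * (1-y^2)
            - (p * |∑ i ∈ Finset.Icc 1 k, e i * kappa p (d i) y| ^ (p-1)
                - 2*(p+1)/(p-1)^2) * r₁ y * q₁ y
            + r₂ y * q₂ y) * (1-y^2) ^ (2/(p-1))| ≤
          C * Real.sqrt (∫ y in Ioo (-1:ℝ) 1,
              ((r₁ y)^2 + (deriv r₁ y)^2 * (1-y^2) + (r₂ y)^2) * (1-y^2) ^ (2/(p-1))) *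
            Real.sqrt (∫ y in Ioo (-1:ℝ) 1,
              ((q₁ y)^2 + (deriv q₁ y)^2 * (1-y^2) + (q₂ y)^2) * (1-y^2) ^ (2/(p-1))) := by
  have hp1 : 0 < p - 1 := by linarith
  set α := 2/(p-1) with hα
  have hα0 : 0 < α := by positivity
  set c := 2*(p+1)/(p-1)^2 with hcd
  have hc : 0 < c := by positivity
  set M := (k:ℝ)^(p-1) * c with hM
  have hM0 : 0 ≤ M := by positivity
  set L := (1 + 1/α + α)/α + 1 with hL
  have hL0 : 0 < L := by positivity
  refine ⟨(1 + p*M + c) * L, by positivity, ?_⟩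
  intro d e hd he r₁ r₂ q₁ q₂ hr hq hr2 hq2 hNr hNq
  obtain ⟨ir, br⟩ := aux_hardy α hα0 r₁ r₂ hr hNr
  obtain ⟨iq, bq⟩ := aux_hardy α hα0 q₁ q₂ hq hNq
  set X := ∫ y in Ioo (-1:ℝ) 1,
    ((r₁ y)^2 + (deriv r₁ y)^2 * (1-y^2) + (r₂ y)^2) * (1-y^2) ^ α with hX
  set Y := ∫ y in Ioo (-1:ℝ) 1,
    ((q₁ y)^2 + (deriv q₁ y)^2 * (1-y^2) + (q₂ y)^2) * (1-y^2) ^ α with hY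
  have hpos : ∀ y ∈ Ioo (-1:ℝ) 1, 0 < 1 - y^2 := fun y hy => by nlinarith [hy.1, hy.2]
  have hF0 : ∀ f g : ℝ → ℝ, ∀ᵐ y ∂(volume.restrict (Ioo (-1:ℝ) 1)), 0 ≤ (f y)^2 * (1-y^2)^(α-1)
      + ((f y)^2 + (deriv f y)^2 * (1-y^2) + (g y)^2) * (1-y^2) ^ α := by
    intro f g
    filter_upwards [ae_restrict_mem measurableSet_Ioo] with y hy
    have := hpos y hy
    positivity
  obtain ⟨hi, hle⟩ := aux_L2 (volume.restrict (Ioo (-1:ℝ) 1))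
    (fun y => (r₁ y)^2 * (1-y^2)^(α-1)
      + ((r₁ y)^2 + (deriv r₁ y)^2 * (1-y^2) + (r₂ y)^2) * (1-y^2) ^ α)
    (fun y => (q₁ y)^2 * (1-y^2)^(α-1)
      + ((q₁ y)^2 + (deriv q₁ y)^2 * (1-y^2) + (q₂ y)^2) * (1-y^2) ^ α) (Integrable.fun_add ir hNr) (Integrable.fun_add iq hNq)
    (hF0 r₁ r₂) (hF0 q₁ q₂)
  have hptw : ∀ᵐ y ∂(volume.restrict (Ioo (-1:ℝ) 1)),
      ‖(deriv r₁ y * deriv q₁ y * (1-y^2)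
            - (p * |∑ i ∈ Finset.Icc 1 k, e i * kappa p (d i) y| ^ (p-1)
                - c) * r₁ y * q₁ y
            + r₂ y * q₂ y) * (1-y^2) ^ α‖ ≤ (1 + p*M + c) *
      (√(((r₁ y)^2 * (1-y^2)^(α-1) +
          ((r₁ y)^2 + (deriv r₁ y)^2 * (1-y^2) + (r₂ y)^2) * (1-y^2) ^ α)) *
       √(((q₁ y)^2 * (1-y^2)^(α-1) +
          ((q₁ y)^2 + (deriv q₁ y)^2 * (1-y^2) + (q₂ y)^2) * (1-y^2) ^ α))) := by
    filter_upwards [ae_restrict_mem measurableSet_Ioo] with y hy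
    have hw := hpos y hy
    have e1 : (1-y^2)^α = (1-y^2) * (1-y^2)^(α-1) := by
      rw [Real.rpow_sub_one hw.ne']
      field_simp
    rw [Real.norm_eq_abs, e1]
    refine (aux_pt2 p M c (1-y^2) ((1-y^2)^(α-1)) _ (r₁ y) _ _ (q₁ y) _ _ (by linarith) hM0 hc.le
      hw (by nlinarith) (by positivity) (by positivity)
      (aux_psi p hp k d e hd he y hy)).trans ?_
    apply mul_le_mul_of_nonneg_left _ (by positivity)
    exact aux_cs _ _ _ _ _ _ _ _ hw (by positivity)
  have hmeas : AEStronglyMeasurable (fun y => (deriv r₁ y * deriv q₁ y * (1-y^2)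
            - (p * |∑ i ∈ Finset.Icc 1 k, e i * kappa p (d i) y| ^ (p-1)
                - c) * r₁ y * q₁ y
            + r₂ y * q₂ y) * (1-y^2) ^ α) (volume.restrict (Ioo (-1:ℝ) 1)) := by
    have m1 : AEMeasurable r₁ (volume.restrict (Ioo (-1:ℝ) 1)) :=
      hr.continuousOn.aemeasurable measurableSet_Ioo
    have m2 : AEMeasurable q₁ (volume.restrict (Ioo (-1:ℝ) 1)) :=
      hq.continuousOn.aemeasurable measurableSet_Ioo
    have m3 := measurable_deriv r₁
    have m4 := measurable_deriv q₁
    have m5 : ∀ d, Measurable (fun y => kappa p d y) := by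
      intro d
      unfold kappa
      fun_prop
    have m6 : Measurable (fun y => |∑ i ∈ Finset.Icc 1 k, e i * kappa p (d i) y| ^ (p-1)) := by
      have : Measurable (fun y => ∑ i ∈ Finset.Icc 1 k, e i * kappa p (d i) y) :=
        Finset.measurable_fun_sum _ fun i _ => (m5 (d i)).const_mul (e i)
      exact (measurable_norm.comp this).pow_const _
    apply AEMeasurable.aestronglyMeasurable
    fun_prop
  have hint := (hi.const_mul (1 + p*M + c)).mono' hmeas hptw
  refine ⟨hint, ?_⟩
  rw [← Real.norm_eq_abs]
  refine (norm_integral_le_of_norm_le (hi.const_mul (1 + p*M + c)) hptw).trans ?_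
  rw [integral_const_mul, mul_assoc ((1 + p*M + c) * L), mul_assoc (1 + p*M + c)]
  apply mul_le_mul_of_nonneg_left _ (by positivity)
  refine hle.trans ?_
  have sX : ∫ y in Ioo (-1:ℝ) 1, ((r₁ y)^2 * (1-y^2)^(α-1) +
          ((r₁ y)^2 + (deriv r₁ y)^2 * (1-y^2) + (r₂ y)^2) * (1-y^2) ^ α) ≤ L * X := by
    rw [integral_add ir hNr, hL, add_mul, one_mul]
    exact add_le_add br le_rfl
  have sY : ∫ y in Ioo (-1:ℝ) 1, ((q₁ y)^2 * (1-y^2)^(α-1) +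
          ((q₁ y)^2 + (deriv q₁ y)^2 * (1-y^2) + (q₂ y)^2) * (1-y^2) ^ α) ≤ L * Y := by
    rw [integral_add iq hNq, hL, add_mul, one_mul]
    exact add_le_add bq le_rfl
  calc _ ≤ √(L*X) * √(L*Y) := by
        exact mul_le_mul (Real.sqrt_le_sqrt sX) (Real.sqrt_le_sqrt sY) (Real.sqrt_nonneg _)
          (Real.sqrt_nonneg _)
    _ = (√L * √L) * (√X * √Y) := by
        rw [Real.sqrt_mul hL0.le, Real.sqrt_mul hL0.le]; ring
    _ = _ := by rw [Real.mul_self_sqrt hL0.le]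
end

section
/- Fix p > 1 and d ∈ (−1,1), and on (−1,1) define κ_d(y) = κ(d,y), f₁(y) = (1−d²)^{p/(p−1)} (1+dy)^{−2/(p−1)−1}, and f₀(y) = (1−d²)^{1/(p−1)} (y+d) (1+dy)^{−2/(p−1)−1}. Then for all y ∈ (−1,1): (a) (1−y²) κ_d''(y) − (2(p+1)/(p−1)) y κ_d'(y) − (2(p+1)/(p−1)²) κ_d(y) + κ_d(y)^p = 0; (b) (1−y²) f₀''(y) − (2(p+1)/(p−1)) y f₀'(y) + ( p κ_d(y)^{p−1} − 2(p+1)/(p−1)² ) f₀(y) = 0; (c) (1−y²) f₁''(y) − (2(p+1)/(p−1)) y f₁'(y) + ( p κ_d(y)^{p−1} − 2(p+1)/(p−1)² ) f₁(y) − ((p+3)/(p−1)) f₁(y) − 2y f₁'(y) = f₁(y). -/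
open Real Set

/-- The soliton `κ_d(y) = κ₀ (1-d²)^{1/(p-1)} (1+dy)^{-2/(p-1)}`,
`κ₀ = (2(p+1)/(p-1)²)^{1/(p-1)}`. -/
noncomputable def kappaD (p d : ℝ) : ℝ → ℝ :=
  fun y => (2*(p+1)/(p-1)^2) ^ (1/(p-1)) * (1-d^2) ^ (1/(p-1)) * (1+d*y) ^ (-(2/(p-1)))

/-- First component of the eigenfunction `F₁(d)` of the linearized operator,
`f₁(y) = (1-d²)^{p/(p-1)} (1+dy)^{-2/(p-1)-1}`. -/
noncomputable def eigF1 (p d : ℝ) : ℝ → ℝ :=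
  fun y => (1-d^2) ^ (p/(p-1)) * (1+d*y) ^ (-(2/(p-1)) - 1)

/-- First component of the null eigenfunction `F₀(d)` of the linearized operator,
`f₀(y) = (1-d²)^{1/(p-1)} (y+d) (1+dy)^{-2/(p-1)-1}`. -/
noncomputable def eigF0 (p d : ℝ) : ℝ → ℝ :=
  fun y => (1-d^2) ^ (1/(p-1)) * (y+d) * (1+d*y) ^ (-(2/(p-1)) - 1)

theorem aux_d1 (d A B b y : ℝ) (hy : 0 < 1 + d*y) :
    HasDerivAt (fun z => (A + B*z) * (1+d*z)^b)
      (B * (1+d*y)^b + (A+B*y) * (b*d*(1+d*y)^(b-1))) y := by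
  have h1 : HasDerivAt (fun z : ℝ => 1 + d*z) d y := by
    simpa using ((hasDerivAt_id y).const_mul d).const_add 1
  have h2 : HasDerivAt (fun z : ℝ => A + B*z) B y := by
    simpa using ((hasDerivAt_id y).const_mul B).const_add A
  have h3 := h1.rpow_const (p := b) (Or.inl hy.ne')
  have h4 := h2.mul h3
  rw [show b*d*(1+d*y)^(b-1) = d*b*(1+d*y)^(b-1) by ring]
  exact h4

theorem aux_d2 (d A B b y : ℝ) (hy : 0 < 1 + d*y) :
    deriv (deriv (fun z => (A + B*z) * (1+d*z)^b)) y
      = 2*B*b*d*(1+d*y)^(b-1) + (A+B*y) * (b*(b-1)*d^2*(1+d*y)^(b-2)) := by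
  have ho : ∀ᶠ z in nhds y, 0 < 1 + d*z :=
    (by fun_prop : Continuous fun z : ℝ => 1 + d*z).continuousAt.eventually (lt_mem_nhds hy)
  have he : deriv (fun z => (A + B*z) * (1+d*z)^b) =ᶠ[nhds y]
      fun z => (B + 0*z) * (1+d*z)^b + (A*b*d+B*b*d*z) * (1+d*z)^(b-1) := by
    filter_upwards [ho] with z hz
    rw [(aux_d1 d A B b z hz).deriv]
    ring
  rw [he.deriv_eq]
  have := ((aux_d1 d B 0 b y hy).add (aux_d1 d (A*b*d) (B*b*d) (b-1) y hy)).deriv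
  refine Eq.trans this ?_
  rw [show b - 1 - 1 = b - 2 by ring]
  ring

/-- (a) `κ_d` is a stationary solution of the selfsimilar equation; (b) `f₀` is a null
eigenfunction of the linearization `ℒ + pκ_d^{p-1} - 2(p+1)/(p-1)²`; (c) `(f₁, f₁)` is an
eigenfunction of the full linearized operator with eigenvalue `1`. Here
`ℒh = (1-y²)h'' - (2(p+1)/(p-1)) y h'`. -/
theorem soliton_eigenfunction_identities (p : ℝ) (hp : 1 < p)
    (d : ℝ) (hd : d ∈ Ioo (-1:ℝ) 1) :
    ∀ y ∈ Ioo (-1:ℝ) 1,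
      ((1-y^2) * deriv (deriv (kappaD p d)) y
          - (2*(p+1)/(p-1)) * y * deriv (kappaD p d) y
          - (2*(p+1)/(p-1)^2) * kappaD p d y + kappaD p d y ^ p = 0) ∧
      ((1-y^2) * deriv (deriv (eigF0 p d)) y
          - (2*(p+1)/(p-1)) * y * deriv (eigF0 p d) y
          + (p * kappaD p d y ^ (p-1) - 2*(p+1)/(p-1)^2) * eigF0 p d y = 0) ∧
      ((1-y^2) * deriv (deriv (eigF1 p d)) y
          - (2*(p+1)/(p-1)) * y * deriv (eigF1 p d) y
          + (p * kappaD p d y ^ (p-1) - 2*(p+1)/(p-1)^2) * eigF1 p d y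
          - ((p+3)/(p-1)) * eigF1 p d y - 2 * y * deriv (eigF1 p d) y
        = eigF1 p d y) := by
  intro y hy
  obtain ⟨hd1, hd2⟩ := hd
  obtain ⟨hy1, hy2⟩ := hy
  have hu : 0 < 1 + d*y := by
    rcases le_total 0 y with h | h <;> nlinarith
  have hD : 0 < 1 - d^2 := by nlinarith
  have hp1 : 0 < p - 1 := by linarith
  obtain ⟨a, ha⟩ : ∃ a, a = 2/(p-1) := ⟨_, rfl⟩
  have ha0 : 0 < a := by rw [ha]; positivity
  have hpa : p = 1 + 2/a := by rw [ha]; field_simp; ring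
  have e1 : 2*(p+1)/(p-1) = 2*a+2 := by rw [hpa]; field_simp; ring
  have e2 : 2*(p+1)/(p-1)^2 = a*(a+1) := by rw [hpa]; field_simp; ring
  have e3 : (p+3)/(p-1) = 2*a+1 := by rw [hpa]; field_simp; ring
  have hK0 : 0 < a*(a+1) := by positivity
  have hkpos : 0 < kappaD p d y := by
    unfold kappaD
    rw [e2]
    positivity
  have hk : kappaD p d y ^ (p-1) * (1+d*y)^2 = a*(a+1)*(1-d^2) := by
    unfold kappaD
    rw [e2, Real.mul_rpow (by positivity) (by positivity),
      Real.mul_rpow (by positivity) (by positivity), ← Real.rpow_mul hK0.le,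
      ← Real.rpow_mul hD.le, ← Real.rpow_mul hu.le,
      show 1/(p-1)*(p-1) = 1 by field_simp,
      show -(2/(p-1))*(p-1) = -2 by field_simp, Real.rpow_one, Real.rpow_one,
      Real.rpow_neg hu.le]
    have : (1+d*y)^(2:ℝ) = (1+d*y)^2 := by exact_mod_cast Real.rpow_natCast (1+d*y) 2
    rw [this]
    field_simp
  have hkp : kappaD p d y ^ p = kappaD p d y ^ (p-1) * kappaD p d y := by
    rw [← Real.rpow_add_one hkpos.ne']
    congr 1
    ring
  rw [hkp, e1, e2, e3]
  generalize kappaD p d y ^ (p-1) = Q at hk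
  have hQ : Q = a*(a+1)*(1-d^2)/(1+d*y)^2 := by
    rw [← hk]; field_simp
  have r1 : (1+d*y)^(-a) = (1+d*y)^3 * (1+d*y)^(-a-3) := by
    rw [← Real.rpow_natCast, ← Real.rpow_add hu]; congr 1; push_cast; ring
  have r2 : (1+d*y)^(-a-1) = (1+d*y)^2 * (1+d*y)^(-a-3) := by
    rw [← Real.rpow_natCast, ← Real.rpow_add hu]; congr 1; push_cast; ring
  have r3 : (1+d*y)^(-a-2) = (1+d*y) * (1+d*y)^(-a-3) := by
    rw [mul_comm (1+d*y) (_ ^ _), ← Real.rpow_add_one hu.ne']; congr 1; ring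
  have s1 : -a-1-1 = -a-2 := by ring
  have s2 : -a-1-2 = -a-3 := by ring
  refine ⟨?_, ?_, ?_⟩
  · obtain ⟨C, hC⟩ : ∃ C, kappaD p d = fun z => (C + 0*z) * (1+d*z)^(-a) :=
      ⟨_, by funext z; unfold kappaD; rw [zero_mul, add_zero, ha]⟩
    rw [hC, aux_d2 _ _ _ _ _ hu, (aux_d1 _ _ _ _ _ hu).deriv]
    simp only [s1, s2, r1, r2, r3, hQ]
    field_simp
    ring
  · obtain ⟨C, hC⟩ : ∃ C, eigF0 p d = fun z => (C*d + C*z) * (1+d*z)^(-a-1) :=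
      ⟨(1-d^2) ^ (1/(p-1)), by funext z; unfold eigF0; rw [ha]; ring⟩
    rw [hC, aux_d2 _ _ _ _ _ hu, (aux_d1 _ _ _ _ _ hu).deriv]
    simp only [s1, s2, r2, r3]
    have hpa' : p * a = a+2 := by rw [hpa]; field_simp
    linear_combination (C*d+C*y)*(1+d*y)^(-a-3)*p*hk
      + (C*d+C*y)*(1+d*y)^(-a-3)*(a+1)*(1-d^2)*hpa'
  · obtain ⟨C, hC⟩ : ∃ C, eigF1 p d = fun z => (C + 0*z) * (1+d*z)^(-a-1) :=
      ⟨_, by funext z; unfold eigF1; rw [zero_mul, add_zero, ha]⟩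
    rw [hC, aux_d2 _ _ _ _ _ hu, (aux_d1 _ _ _ _ _ hu).deriv]
    simp only [s1, s2, r2, r3]
    have hpa' : p * a = a+2 := by rw [hpa]; field_simp
    linear_combination C*(1+d*y)^(-a-3)*p*hk
      + C*(1+d*y)^(-a-3)*(a+1)*(1-d^2)*hpa'
end

section
/- Fix p > 1. There exists a constant C > 0, depending only on p, such that for every ε ∈ [0,1] and every measurable function w : (−1,1) → ℝ satisfying w(y) ≥ −ε for almost every y ∈ (−1,1) and ∫_{−1}^{1} |w(y)|^{p+1} ρ(y) dy < ∞, the following hold: (a) ∫_{−1}^{1} |w|^{p} w ρ dy ≤ ∫_{−1}^{1} |w|^{p+1} ρ dy; (b) ∫_{−1}^{1} |w|^{p} w ρ dy ≥ (1/2) ∫_{−1}^{1} |w|^{p+1} ρ dy − C ε^{p+1}; (c) ∫_{−1}^{1} |w|^{p} w ρ dy ≥ (1 − 2ε) ∫_{−1}^{1} |w|^{p+1} ρ dy − C ε. -/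
open Real MeasureTheory Set

/-- Comparison between the signed nonlinear term `∫ |w|^p w ρ` and `∫ |w|^{p+1} ρ`,
`ρ(y) = (1-y²)^{2/(p-1)}`, for functions bounded below by `-ε` on `(-1,1)` with
`ε ∈ [0,1]`: (a) `∫|w|^p w ρ ≤ ∫|w|^{p+1} ρ`;
(b) `∫|w|^p w ρ ≥ (1/2)∫|w|^{p+1} ρ - C ε^{p+1}`;
(c) `∫|w|^p w ρ ≥ (1-2ε)∫|w|^{p+1} ρ - C ε`. -/
theorem nonlinear_term_comparison (p : ℝ) (hp : 1 < p) :
    ∃ C > (0:ℝ), ∀ ε ∈ Set.Icc (0:ℝ) 1, ∀ w : ℝ → ℝ,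
      Measurable w →
      (∀ᵐ y ∂(volume.restrict (Ioo (-1:ℝ) 1)), -ε ≤ w y) →
      IntegrableOn (fun y => |w y| ^ (p+1) * (1-y^2) ^ (2/(p-1))) (Ioo (-1:ℝ) 1) →
      ((∫ y in Ioo (-1:ℝ) 1, |w y| ^ p * w y * (1-y^2) ^ (2/(p-1))) ≤
          ∫ y in Ioo (-1:ℝ) 1, |w y| ^ (p+1) * (1-y^2) ^ (2/(p-1))) ∧
      ((1/2) * (∫ y in Ioo (-1:ℝ) 1, |w y| ^ (p+1) * (1-y^2) ^ (2/(p-1)))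
          - C * ε ^ (p+1) ≤
        ∫ y in Ioo (-1:ℝ) 1, |w y| ^ p * w y * (1-y^2) ^ (2/(p-1))) ∧
      ((1 - 2*ε) * (∫ y in Ioo (-1:ℝ) 1, |w y| ^ (p+1) * (1-y^2) ^ (2/(p-1)))
          - C * ε ≤
        ∫ y in Ioo (-1:ℝ) 1, |w y| ^ p * w y * (1-y^2) ^ (2/(p-1))) := by
  refine ⟨4, by norm_num, ?_⟩
  intro ε hε w hw hlow hint
  obtain ⟨h0, h1⟩ := hε
  have hq : 0 ≤ 2 / (p - 1) := div_nonneg (by norm_num) (by linarith)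
  have hρ : ∀ y ∈ Ioo (-1:ℝ) 1, 0 ≤ (1-y^2) ^ (2/(p-1)) ∧ (1-y^2) ^ (2/(p-1)) ≤ 1 := by
    intro y hy
    have h : 0 ≤ 1 - y^2 := by nlinarith [hy.1, hy.2]
    exact ⟨Real.rpow_nonneg h _, Real.rpow_le_one h (by nlinarith [sq_nonneg y]) hq⟩
  have hpow : ∀ x : ℝ, |x| ^ (p+1) = |x| ^ p * |x| := by
    intro x
    rw [Real.rpow_add_of_nonneg (abs_nonneg x) (by linarith) (by norm_num), Real.rpow_one]
  have hmem : ∀ᵐ y ∂(volume.restrict (Ioo (-1:ℝ) 1)), y ∈ Ioo (-1:ℝ) 1 :=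
    ae_restrict_mem measurableSet_Ioo
  have hint' : IntegrableOn (fun y => |w y| ^ p * w y * (1-y^2) ^ (2/(p-1))) (Ioo (-1:ℝ) 1) := by
    refine Integrable.mono hint (Measurable.aestronglyMeasurable (by fun_prop)) ?_
    refine Filter.Eventually.of_forall fun y => le_of_eq ?_
    simp only [hpow, norm_mul, Real.norm_eq_abs, abs_abs]
  have ha : (∫ y in Ioo (-1:ℝ) 1, |w y| ^ p * w y * (1-y^2) ^ (2/(p-1))) ≤
          ∫ y in Ioo (-1:ℝ) 1, |w y| ^ (p+1) * (1-y^2) ^ (2/(p-1)) := by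
    refine integral_mono_ae hint' hint ?_
    filter_upwards [hmem] with y hy
    rw [hpow]
    have := (hρ y hy).1
    have := le_abs_self (w y)
    gcongr
  have hI : 0 ≤ ∫ y in Ioo (-1:ℝ) 1, |w y| ^ (p+1) * (1-y^2) ^ (2/(p-1)) := by
    refine integral_nonneg_of_ae ?_
    filter_upwards [hmem] with y hy
    exact mul_nonneg (by positivity) (hρ y hy).1
  have hc : IntegrableOn (fun _ : ℝ => 2 * ε ^ (p+1)) (Ioo (-1:ℝ) 1) :=
    integrableOn_const (by simp)
  have hE : 0 ≤ ε ^ (p+1) := Real.rpow_nonneg h0 _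
  have hE1 : ε ^ (p+1) ≤ ε := by
    simpa using Real.rpow_le_rpow_of_exponent_ge_of_imp h0 h1 (show (1:ℝ) ≤ p + 1 by linarith)
      (by intro _ h; linarith)
  have key : (∫ y in Ioo (-1:ℝ) 1, |w y| ^ (p+1) * (1-y^2) ^ (2/(p-1))) - 4 * ε ^ (p+1) ≤
      ∫ y in Ioo (-1:ℝ) 1, |w y| ^ p * w y * (1-y^2) ^ (2/(p-1)) := by
    have e : ∫ _ in Ioo (-1:ℝ) 1, 2 * ε ^ (p+1) = 4 * ε ^ (p+1) := by
      rw [setIntegral_const]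
      simp
      ring
    rw [← e, ← integral_sub hint hc]
    refine integral_mono_ae (hint.sub hc) hint' ?_
    filter_upwards [hmem, hlow] with y hy hl
    obtain ⟨r0, r1⟩ := hρ y hy
    rcases le_total 0 (w y) with h | h
    · rw [hpow, abs_of_nonneg h]
      linarith
    · have hb : |w y| ^ (p+1) ≤ ε ^ (p+1) := by
        apply Real.rpow_le_rpow (abs_nonneg _) _ (by linarith)
        rw [abs_of_nonpos h]; linarith
      have hw' : |w y| ^ p * w y = - |w y| ^ (p+1) := by
        rw [hpow]; nth_rewrite 3 [abs_of_nonpos h]; ring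
      rw [hw']
      have hA : 0 ≤ |w y| ^ (p+1) := by positivity
      nlinarith [mul_le_mul hb r1 r0 hE]
  refine ⟨ha, ?_, ?_⟩
  · linarith
  · nlinarith [mul_nonneg h0 hI]
end

section
/- Fix p > 1 and set a = 2p/(p−1), b = 2/(p−1). Then the constant c₁ = 2^b ∫_ℝ cosh(z)^{−a} tanh(z) e^{bz} dz is finite and strictly positive, and e^{b L₂} ∫_{−L₁/2}^{L₂/2} cosh(z)^{−a} tanh(z) cosh(z − L₂)^{−b} dz → c₁ as min(L₁, L₂) → +∞ (L₁, L₂ > 0). -/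
open Real Filter MeasureTheory

lemma aux_cosh_pow_cont (a c : ℝ) : Continuous (fun z : ℝ => Real.cosh (z - c) ^ a) := by
  refine Continuous.rpow_const (by fun_prop) ?_
  intro x
  exact Or.inl (Real.cosh_pos _).ne'

lemma aux_tanh_cont : Continuous (fun z : ℝ => Real.tanh z) := by
  simp only [Real.tanh_eq_sinh_div_cosh]
  exact Real.continuous_sinh.div Real.continuous_cosh (fun x => (Real.cosh_pos x).ne')

lemma aux_cont (a b : ℝ) : Continuous (fun z : ℝ =>
    Real.cosh z ^ a * Real.tanh z * Real.exp (b * z)) := by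
  have h := aux_cosh_pow_cont a 0
  simp only [sub_zero] at h
  exact (h.mul aux_tanh_cont).mul (by fun_prop)

lemma aux_cosh_sq (z : ℝ) : 1 + z ^ 2 ≤ Real.cosh z ^ 2 := by
  have h1 : |z| ≤ |Real.sinh z| := by
    rw [Real.abs_sinh]
    exact Real.self_le_sinh_iff.2 (abs_nonneg z)
  have h2 := sq_le_sq.2 h1
  rw [Real.cosh_sq]
  linarith

/-- If `exp w ≤ 2 cosh w`, raise to a power. -/
lemma aux_exp_le (b : ℝ) (hb : 0 < b) (w : ℝ) :
    Real.exp (b * w) ≤ 2 ^ b * Real.cosh w ^ b := by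
  rw [← Real.mul_rpow (by norm_num) (Real.cosh_pos _).le, mul_comm b w, Real.exp_mul]
  refine Real.rpow_le_rpow (Real.exp_pos _).le ?_ hb.le
  rw [Real.cosh_eq]
  have := Real.exp_pos (-w)
  linarith

lemma aux_bound_s19 (b : ℝ) (hb : 0 < b) (z : ℝ) :
    ‖Real.cosh z ^ (-(b + 2)) * Real.tanh z * Real.exp (b * z)‖ ≤ 2 ^ b * (1 + z ^ 2)⁻¹ := by
  have hc := Real.cosh_pos z
  have hcb : 0 < Real.cosh z ^ b := Real.rpow_pos_of_pos hc _
  have h1 : Real.cosh z ^ (-(b + 2)) = (Real.cosh z ^ b)⁻¹ * (Real.cosh z ^ 2)⁻¹ := by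
    rw [Real.rpow_neg hc.le, Real.rpow_add hc, mul_inv]
    norm_num
  have h2 : (Real.cosh z ^ 2)⁻¹ ≤ (1 + z ^ 2)⁻¹ :=
    inv_anti₀ (by positivity) (aux_cosh_sq z)
  rw [norm_mul, norm_mul, Real.norm_eq_abs, Real.norm_eq_abs, Real.norm_eq_abs, h1,
    abs_of_pos (Real.exp_pos _), abs_of_pos (by positivity)]
  calc _ ≤ (Real.cosh z ^ b)⁻¹ * (1 + z ^ 2)⁻¹ * 1 * (2 ^ b * Real.cosh z ^ b) := by
        gcongr
        · exact (Real.abs_tanh_lt_one z).le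
        · exact aux_exp_le b hb z
    _ = _ := by field_simp

lemma aux_integrable (b : ℝ) (hb : 0 < b) : Integrable (fun z : ℝ =>
    Real.cosh z ^ (-(b + 2)) * Real.tanh z * Real.exp (b * z)) :=
  (integrable_inv_one_add_sq.const_mul ((2:ℝ) ^ b)).mono'
    (aux_cont _ _).aestronglyMeasurable (ae_of_all _ (aux_bound_s19 b hb))

lemma aux_pos_s19 (b : ℝ) (hb : 0 < b) :
    0 < ∫ z : ℝ, Real.cosh z ^ (-(b + 2)) * Real.tanh z * Real.exp (b * z) := by
  set F : ℝ → ℝ := fun z => Real.cosh z ^ (-(b + 2)) * Real.tanh z * Real.exp (b * z) with hF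
  have hi : Integrable F := aux_integrable b hb
  have hi' : Integrable (fun z => F (-z)) := hi.comp_neg
  have e1 : ∫ z, F (-z) = ∫ z, F z := integral_neg_eq_self F volume
  have e2 : ∫ z, (F z + F (-z)) = (∫ z, F z) + ∫ z, F (-z) := integral_add hi hi'
  have e3 : ∀ z, F z + F (-z) =
      Real.cosh z ^ (-(b + 2)) * (Real.cosh z)⁻¹ * 2 * (Real.sinh z * Real.sinh (b * z)) := by
    intro z
    simp only [hF, Real.cosh_neg, Real.sinh_neg, mul_neg, Real.sinh_eq (b * z),
      Real.tanh_eq_sinh_div_cosh]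
    ring
  have hp : 0 < ∫ z, (F z + F (-z)) := by
    have hFc : Continuous F := aux_cont _ _
    refine integral_pos_of_integrable_nonneg_nonzero (x := 1)
      (hFc.add (hFc.comp continuous_neg)) (hi.add hi') ?_ ?_
    · intro z
      simp only [Pi.zero_apply]
      rw [e3]
      have hc := Real.cosh_pos z
      refine mul_nonneg (by positivity) ?_
      rcases le_total 0 z with h | h
      · exact mul_nonneg (Real.sinh_nonneg_iff.2 h) (Real.sinh_nonneg_iff.2 (by positivity))
      · exact mul_nonneg_of_nonpos_of_nonpos (Real.sinh_nonpos_iff.2 h)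
          (Real.sinh_nonpos_iff.2 (mul_nonpos_of_nonneg_of_nonpos hb.le h))
    · show F 1 + F (-1) ≠ 0
      rw [e3]
      have hc := Real.cosh_pos 1
      have h1 : 0 < Real.sinh 1 := Real.sinh_pos_iff.2 one_pos
      have h2 : 0 < Real.sinh (b * 1) := Real.sinh_pos_iff.2 (by linarith)
      positivity
  rw [e2, e1] at hp
  linarith

lemma aux_eq (b L z : ℝ) : Real.exp (b * L) * Real.cosh (z - L) ^ (-b) =
    ((Real.exp (-z) + Real.exp (z - 2 * L)) / 2) ^ (-b) := by
  have h : Real.exp (b * L) = Real.exp (-L) ^ (-b) := by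
    rw [← Real.exp_mul]; ring_nf
  rw [h, ← Real.mul_rpow (Real.exp_pos _).le (Real.cosh_pos _).le, Real.cosh_eq]
  congr 1
  rw [mul_div_assoc', mul_add, ← Real.exp_add, ← Real.exp_add]
  ring_nf

lemma aux_lim_eq (b z : ℝ) : ((Real.exp (-z) + 0) / 2) ^ (-b) = 2 ^ b * Real.exp (b * z) := by
  rw [add_zero, Real.div_rpow (Real.exp_pos _).le (by norm_num), ← Real.exp_mul,
    Real.rpow_neg (by norm_num), div_inv_eq_mul]
  ring_nf

lemma aux_tendsto (b : ℝ) (hb : 0 < b) :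
    Tendsto
      (fun L : ℝ × ℝ =>
        Real.exp (b * L.2) *
          ∫ z in (-(L.1/2))..(L.2/2),
            Real.cosh z ^ (-(b + 2)) * Real.tanh z * Real.cosh (z - L.2) ^ (-b))
      (atTop ×ˢ atTop)
      (nhds ((2:ℝ) ^ b *
        ∫ z : ℝ, Real.cosh z ^ (-(b + 2)) * Real.tanh z * Real.exp (b * z))) := by
  have t1 : Tendsto (fun L : ℝ × ℝ => -(L.1/2)) (atTop ×ˢ atTop) atBot :=
    tendsto_neg_atTop_atBot.comp (tendsto_fst.atTop_div_const (by norm_num))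
  have t2 : Tendsto (fun L : ℝ × ℝ => L.2/2) (atTop ×ˢ atTop) atTop :=
    tendsto_snd.atTop_div_const (by norm_num)
  have hcov : AECover (volume : Measure ℝ) (atTop ×ˢ atTop)
      (fun L : ℝ × ℝ => Set.Ioc (-(L.1/2)) (L.2/2)) := aecover_Ioc t1 t2
  rw [← integral_const_mul]
  have key : Tendsto (fun L : ℝ × ℝ => ∫ z, (Set.Ioc (-(L.1/2)) (L.2/2)).indicator
      (fun z => Real.exp (b * L.2) *
        (Real.cosh z ^ (-(b + 2)) * Real.tanh z * Real.cosh (z - L.2) ^ (-b))) z)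
      (atTop ×ˢ atTop)
      (nhds (∫ z : ℝ, 2 ^ b * (Real.cosh z ^ (-(b + 2)) * Real.tanh z * Real.exp (b * z)))) := by
    refine tendsto_integral_filter_of_dominated_convergence
      (fun z => 2 ^ b * ‖Real.cosh z ^ (-(b + 2)) * Real.tanh z * Real.exp (b * z)‖) ?_ ?_
      ((aux_integrable b hb).norm.const_mul _) ?_
    · refine Eventually.of_forall fun L => ?_
      refine AEStronglyMeasurable.indicator ?_ measurableSet_Ioc
      have h := aux_cosh_pow_cont (-(b + 2)) 0
      simp only [sub_zero] at h
      exact (continuous_const.mul ((h.mul aux_tanh_cont).mul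
        (aux_cosh_pow_cont (-b) L.2))).aestronglyMeasurable
    · refine Eventually.of_forall fun L => ae_of_all _ fun z => ?_
      refine (norm_indicator_le_norm_self _ _).trans ?_
      have e : Real.exp (b * L.2) *
        (Real.cosh z ^ (-(b + 2)) * Real.tanh z * Real.cosh (z - L.2) ^ (-b)) =
        (Real.cosh z ^ (-(b + 2)) * Real.tanh z) *
          (Real.exp (b * L.2) * Real.cosh (z - L.2) ^ (-b)) := by ring
      rw [e, norm_mul, norm_mul _ (Real.exp (b * z)), mul_left_comm]
      refine mul_le_mul_of_nonneg_left ?_ (norm_nonneg _)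
      rw [aux_eq, Real.norm_eq_abs, Real.norm_eq_abs, abs_of_pos (Real.exp_pos _),
        abs_of_pos (by positivity), ← aux_lim_eq]
      refine Real.rpow_le_rpow_of_nonpos (by positivity) ?_ (by linarith)
      gcongr
      positivity
    · refine ae_of_all _ fun z => ?_
      have hlim : Tendsto (fun L : ℝ × ℝ =>
          (Real.cosh z ^ (-(b + 2)) * Real.tanh z) *
          ((Real.exp (-z) + Real.exp (z - 2 * L.2)) / 2) ^ (-b)) (atTop ×ˢ atTop)
          (nhds ((Real.cosh z ^ (-(b + 2)) * Real.tanh z) *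
            ((Real.exp (-z) + 0) / 2) ^ (-b))) := by
        refine Tendsto.const_mul _ ?_
        refine Tendsto.rpow_const ?_ (Or.inl (by positivity))
        refine Tendsto.div_const (Tendsto.const_add _ ?_) _
        refine Real.tendsto_exp_atBot.comp ?_
        have : Tendsto (fun L : ℝ × ℝ => 2 * L.2) (atTop ×ˢ atTop) atTop :=
          tendsto_snd.const_mul_atTop (by norm_num)
        exact tendsto_atBot_add_const_left _ z (tendsto_neg_atTop_atBot.comp this)
      rw [aux_lim_eq, mul_left_comm] at hlim
      refine hlim.congr' ?_
      filter_upwards [t1.eventually_lt_atBot z, t2.eventually_ge_atTop z] with L h1 h2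
      rw [Set.indicator_of_mem (Set.mem_Ioc.2 ⟨h1, h2⟩), ← aux_eq]
      ring
  refine key.congr' ?_
  filter_upwards [t1.eventually_lt_atBot 0, t2.eventually_ge_atTop 0] with L h1 h2
  rw [integral_indicator measurableSet_Ioc, ← intervalIntegral.integral_of_le (h1.le.trans h2),
    intervalIntegral.integral_const_mul]

/-- Leading-order interaction integral between neighbouring solitons: with
`a = 2p/(p-1)` and `b = 2/(p-1)`, the constant
`c₁ = 2^b ∫ cosh(z)^{-a} tanh(z) e^{bz} dz` is finite and strictly positive, and
`e^{bL₂} ∫_{-L₁/2}^{L₂/2} cosh(z)^{-a} tanh(z) cosh(z-L₂)^{-b} dz → c₁` as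
`min(L₁, L₂) → ∞`. -/
theorem interaction_integral_asymptotics (p : ℝ) (hp : 1 < p) :
    Integrable (fun z : ℝ =>
      Real.cosh z ^ (-(2*p/(p-1))) * Real.tanh z * Real.exp ((2/(p-1)) * z)) ∧
    0 < (2:ℝ) ^ (2/(p-1)) *
      ∫ z : ℝ, Real.cosh z ^ (-(2*p/(p-1))) * Real.tanh z * Real.exp ((2/(p-1)) * z) ∧
    Tendsto
      (fun L : ℝ × ℝ =>
        Real.exp ((2/(p-1)) * L.2) *
          ∫ z in (-(L.1/2))..(L.2/2),
            Real.cosh z ^ (-(2*p/(p-1))) * Real.tanh z *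
              Real.cosh (z - L.2) ^ (-(2/(p-1))))
      (atTop ×ˢ atTop)
      (nhds ((2:ℝ) ^ (2/(p-1)) *
        ∫ z : ℝ, Real.cosh z ^ (-(2*p/(p-1))) * Real.tanh z *
          Real.exp ((2/(p-1)) * z))) := by
  have hp' : p - 1 ≠ 0 := by linarith
  have hb : 0 < 2 / (p - 1) := div_pos two_pos (by linarith)
  have ha : 2 * p / (p - 1) = 2 / (p - 1) + 2 := by field_simp; ring
  rw [ha]
  exact ⟨aux_integrable _ hb, mul_pos (by positivity) (aux_pos_s19 _ hb), aux_tendsto _ hb⟩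
end
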